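/- arXiv:1910.08782 — 4 statements merged into one kernel-verified Lean document; each statement's English description precedes it below -/
import Mathlib

section
/- (Riemann theta relation, variant (R₅)) For every τ in the upper half-plane ℍ and all z₁, z₂, z₃, z₄ ∈ ℂ, set p₁ = (z₁+z₂+z₃+z₄)/2, p₂ = (z₁+z₂−z₃−z₄)/2, p₃ = (z₁−z₂+z₃−z₄)/2, p₄ = (z₁−z₂−z₃+z₄)/2 and m₁ = (z₁+z₂+z₃−z₄)/2, m₂ = (z₁+z₂−z₃+z₄)/2, m₃ = (z₁−z₂+z₃+z₄)/2, m₄ = (z₁−z₂−z₃−z₄)/2. Then ϑ(τ,z₁)ϑ(τ,z₂)ϑ(τ,z₃)ϑ(τ,z₄) + ϑ(τ,m₁)ϑ(τ,m₂)ϑ(τ,m₃)ϑ(τ,m₄) = ϑ(τ,p₁)ϑ(τ,p₂)ϑ(τ,p₃)ϑ(τ,p₄). -/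
open Complex

/-- The odd Jacobi theta function
`ϑ(τ,z) = e^{πiτ/4}(e^{πiz} − e^{−πiz}) ∏_{n≥1} (1−qⁿe^{2πiz})(1−qⁿe^{−2πiz})(1−qⁿ)`,
where `q = e^{2πiτ}`. -/
noncomputable def jTheta (τ z : ℂ) : ℂ :=
  Complex.exp (Real.pi * Complex.I * τ / 4) *
    (Complex.exp (Real.pi * Complex.I * z) - Complex.exp (-(Real.pi * Complex.I * z))) *
    ∏' n : ℕ,
      ((1 - Complex.exp (2 * Real.pi * Complex.I * τ) ^ (n + 1) *
            Complex.exp (2 * Real.pi * Complex.I * z)) *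
       (1 - Complex.exp (2 * Real.pi * Complex.I * τ) ^ (n + 1) *
            Complex.exp (-(2 * Real.pi * Complex.I * z))) *
       (1 - Complex.exp (2 * Real.pi * Complex.I * τ) ^ (n + 1)))

/-- Gaussian binomial coefficients. -/
noncomputable def gaussB (q : ℂ) : ℕ → ℕ → ℂ
  | _, 0 => 1
  | 0, _ + 1 => 0
  | M + 1, j + 1 => gaussB q M j + q ^ (j + 1) * gaussB q M (j + 1)

noncomputable def qFac (q : ℂ) (n : ℕ) : ℂ := ∏ i ∈ Finset.range n, (1 - q ^ (i + 1))

lemma gaussB_zero_right (q : ℂ) (M : ℕ) : gaussB q M 0 = 1 := by cases M <;> simp [gaussB]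

lemma gaussB_gt (q : ℂ) (M j : ℕ) (h : M < j) : gaussB q M j = 0 := by
  induction M generalizing j with
  | zero => obtain ⟨k, rfl⟩ : ∃ k, j = k + 1 := ⟨j - 1, by omega⟩
            simp [gaussB]
  | succ M ih =>
    obtain ⟨k, rfl⟩ : ∃ k, j = k + 1 := ⟨j - 1, by omega⟩
    rw [gaussB, ih k (by omega), ih (k + 1) (by omega)]; simp

lemma gaussB_self (q : ℂ) (M : ℕ) : gaussB q M M = 1 := by
  induction M with
  | zero => simp [gaussB]
  | succ M ih => rw [gaussB, ih, gaussB_gt q M (M + 1) (by omega)]; simp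

lemma gaussB_formula (q : ℂ) (s a b : ℕ) (h : a + b = s) :
    gaussB q s a * (qFac q a * qFac q b) = qFac q s := by
  induction s generalizing a b with
  | zero =>
    obtain rfl : a = 0 := by omega
    obtain rfl : b = 0 := by omega
    simp [gaussB, qFac]
  | succ s ih =>
    cases a with
    | zero => obtain rfl : b = s + 1 := by omega
              rw [gaussB_zero_right]; simp [qFac]
    | succ a =>
      cases b with
      | zero =>
        obtain rfl : a = s := by omega
        rw [gaussB_self]; simp [qFac]
      | succ b =>
        obtain rfl : s = a + (b + 1) := by omega
        have h1 := ih a (b + 1) rfl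
        have h2 := ih (a + 1) b (by omega)
        rw [gaussB]
        have e (n : ℕ) : qFac q (n + 1) = qFac q n * (1 - q ^ (n + 1)) := by
          simp [qFac, Finset.prod_range_succ]
        rw [e (a + (b + 1))]
        rw [e b] at h1 ⊢
        rw [e a] at h2 ⊢
        linear_combination (1 - q ^ (a + 1)) * h1 + q ^ (a + 1) * (1 - q ^ (b + 1)) * h2

lemma pascal_sum (q : ℂ) (M : ℕ) (s : ℕ → ℂ) :
    ∑ j ∈ Finset.range (M + 2), gaussB q (M + 1) j * s j =
      ∑ j ∈ Finset.range (M + 1), gaussB q M j * (q ^ j * s j + s (j + 1)) := by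
  have h : ∑ j ∈ Finset.range (M + 1), gaussB q M j * (q ^ j * s j) =
      ∑ j ∈ Finset.range (M + 1), gaussB q M (j + 1) * (q ^ (j + 1) * s (j + 1)) + s 0 := by
    have h1 := Finset.sum_range_succ (fun j => gaussB q M j * (q ^ j * s j)) (M + 1)
    rw [Finset.sum_range_succ', gaussB_gt q M (M + 1) (by omega), gaussB_zero_right] at h1
    simpa using h1.symm
  rw [Finset.sum_range_succ', gaussB_zero_right]
  simp only [mul_add, Finset.sum_add_distrib, gaussB]
  rw [h]
  simp only [add_mul, Finset.sum_add_distrib]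
  have : ∑ j ∈ Finset.range (M + 1), q ^ (j + 1) * gaussB q M (j + 1) * s (j + 1) =
    ∑ j ∈ Finset.range (M + 1), gaussB q M (j + 1) * (q ^ (j + 1) * s (j + 1)) :=
    Finset.sum_congr rfl fun j _ => by ring
  rw [this]; ring

noncomputable def tTerm (τ z : ℂ) (n : ℤ) : ℂ := jacobiTheta₂_term n (z + 1 / 2 - τ / 2) τ

local notation "qq" τ => cexp (2 * Real.pi * I * τ)

lemma tTerm_zero (τ z : ℂ) : tTerm τ z 0 = 1 := by simp [tTerm, jacobiTheta₂_term]

lemma tTerm_succ (τ z : ℂ) (n : ℤ) : tTerm τ z (n + 1) = - (qq z) * (qq τ) ^ n * tTerm τ z n := by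
  unfold tTerm jacobiTheta₂_term
  rw [← Complex.exp_int_mul, neg_eq_neg_one_mul, ← Complex.exp_pi_mul_I, ← Complex.exp_add,
    ← Complex.exp_add, ← Complex.exp_add]
  congr 1
  push_cast
  ring

lemma tTerm_shift (τ z : ℂ) (n : ℤ) : tTerm τ (z + τ) n = (qq τ) ^ n * tTerm τ z n := by
  unfold tTerm jacobiTheta₂_term
  rw [← Complex.exp_int_mul, ← Complex.exp_add]
  congr 1
  ring

lemma finite_right (τ z : ℂ) (a : ℕ) :
    ∏ k ∈ Finset.range a, (1 - (qq τ) ^ k * (qq z)) =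
      ∑ j ∈ Finset.range (a + 1), gaussB (qq τ) a j * tTerm τ z j := by
  induction a generalizing z with
  | zero => simp [gaussB, tTerm_zero]
  | succ a ih =>
    rw [pascal_sum, Finset.prod_range_succ']
    have h : ∏ k ∈ Finset.range a, (1 - (qq τ) ^ (k + 1) * (qq z)) =
        ∏ k ∈ Finset.range a, (1 - (qq τ) ^ k * (qq (z + τ))) := by
      refine Finset.prod_congr rfl fun k _ => ?_
      rw [mul_add, Complex.exp_add]; ring
    rw [h, ih, Finset.sum_mul]
    refine Finset.sum_congr rfl fun j _ => ?_
    rw [tTerm_shift]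
    push_cast
    rw [tTerm_succ, zpow_natCast]
    ring

lemma finite_triple (τ z : ℂ) (a b : ℕ) :
    (∏ k ∈ Finset.range a, (1 - (qq τ) ^ k * (qq z))) *
      ∏ k ∈ Finset.range b, (1 - (qq τ) ^ (k + 1) * cexp (-(2 * Real.pi * I * z))) =
      ∑ j ∈ Finset.range (a + b + 1), gaussB (qq τ) (a + b) j * tTerm τ z ((j : ℤ) - b) := by
  induction b with
  | zero => simp [finite_right]
  | succ b ih =>
    rw [Finset.prod_range_succ, ← mul_assoc, ih, ← add_assoc, pascal_sum, Finset.sum_mul]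
    refine Finset.sum_congr rfl fun j _ => ?_
    have h := tTerm_succ τ z ((j : ℤ) - (b + 1))
    rw [show (j : ℤ) - (b + 1) + 1 = j - b by ring] at h
    push_cast
    rw [show (j : ℤ) + 1 - (b + 1) = j - b by ring, h, zpow_sub₀ (Complex.exp_ne_zero _),
      Complex.exp_neg]
    have h1 := Complex.exp_ne_zero (2 * Real.pi * I * z)
    have h2 := Complex.exp_ne_zero (2 * Real.pi * I * τ)
    rw [zpow_natCast]
    rw [show ((b : ℤ) + 1) = ((b + 1 : ℕ) : ℤ) by push_cast; rfl, zpow_natCast]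
    field_simp
    ring

open Filter Topology

lemma norm_qq (τ : ℂ) (hτ : 0 < τ.im) : ‖qq τ‖ < 1 :=
  UpperHalfPlane.norm_exp_two_pi_I_lt_one ⟨τ, hτ⟩

lemma summable_pow_norm {q : ℂ} (hq : ‖q‖ < 1) (c : ℂ) :
    Summable (fun n : ℕ => ‖-(q ^ (n + 1) * c)‖) := by
  simp only [norm_neg, norm_mul, norm_pow]
  exact ((summable_nat_add_iff 1).mpr (summable_geometric_of_lt_one (norm_nonneg _) hq)).mul_right _

lemma multipliable_aux {q : ℂ} (hq : ‖q‖ < 1) (c : ℂ) :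
    Multipliable (fun n : ℕ => 1 - q ^ (n + 1) * c) := by
  simpa only [sub_eq_add_neg] using multipliable_one_add_of_summable (summable_pow_norm hq c)

lemma one_sub_pow_ne {q : ℂ} (hq : ‖q‖ < 1) (n : ℕ) : 1 - q ^ (n + 1) ≠ 0 := by
  intro h
  have h1 : ‖q ^ (n + 1)‖ < 1 := by
    rw [norm_pow]; exact pow_lt_one₀ (norm_nonneg _) hq (by omega)
  rw [← sub_eq_zero.mp h] at h1
  simp at h1

lemma qFac_ne {q : ℂ} (hq : ‖q‖ < 1) (n : ℕ) : qFac q n ≠ 0 :=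
  Finset.prod_ne_zero_iff.mpr fun i _ => one_sub_pow_ne hq i

lemma qFac_tendsto {q : ℂ} (hq : ‖q‖ < 1) :
    ∃ L : ℂ, L ≠ 0 ∧ Tendsto (qFac q) atTop (𝓝 L) := by
  refine ⟨∏' n : ℕ, (1 + -(q ^ (n + 1) * 1)), ?_, ?_⟩
  · refine tprod_one_add_ne_zero_of_summable (fun i => ?_) (summable_pow_norm hq 1)
    simpa [← sub_eq_add_neg] using one_sub_pow_ne hq i
  · have := (multipliable_one_add_of_summable (summable_pow_norm hq 1)).tendsto_prod_tprod_nat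
    refine this.congr fun n => ?_
    simp [qFac, sub_eq_add_neg]

lemma gaussB_eq {q : ℂ} (hq : ‖q‖ < 1) (s a b : ℕ) (h : a + b = s) :
    gaussB q s a = qFac q s * (qFac q a)⁻¹ * (qFac q b)⁻¹ := by
  have h1 := qFac_ne hq a
  have h2 := qFac_ne hq b
  rw [← gaussB_formula q s a b h]
  field_simp

lemma gaussB_bound {q : ℂ} (hq : ‖q‖ < 1) : ∃ C : ℝ, 0 ≤ C ∧ ∀ M j, ‖gaussB q M j‖ ≤ C := by
  obtain ⟨L, hL, hT⟩ := qFac_tendsto hq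
  obtain ⟨A, hA⟩ := (Metric.isBounded_range_of_tendsto _ hT).exists_norm_le
  obtain ⟨B, hB⟩ := (Metric.isBounded_range_of_tendsto _ (hT.inv₀ hL)).exists_norm_le
  have hA' (n : ℕ) : ‖qFac q n‖ ≤ A := hA _ ⟨n, rfl⟩
  have hB' (n : ℕ) : ‖(qFac q n)⁻¹‖ ≤ B := hB _ ⟨n, rfl⟩
  have a0 : 0 ≤ A := (norm_nonneg _).trans (hA' 0)
  have b0 : 0 ≤ B := (norm_nonneg _).trans (hB' 0)
  refine ⟨A * B * B, by positivity, fun M j => ?_⟩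
  by_cases h : M < j
  · rw [gaussB_gt q M j h, norm_zero]; positivity
  · rw [gaussB_eq hq M j (M - j) (by omega), norm_mul, norm_mul]
    gcongr
    · exact hA' _
    · exact hB' _
    · exact hB' _

/-- the finite sum, extended by zero to the integers -/
noncomputable def fTerm (τ z : ℂ) (N : ℕ) (n : ℤ) : ℂ :=
  if 0 ≤ n + N then gaussB (qq τ) (N + 1 + N) (n + N).toNat * tTerm τ z n else 0

lemma finite_tsum (τ z : ℂ) (N : ℕ) :
    (∏ k ∈ Finset.range (N + 1), (1 - (qq τ) ^ k * (qq z))) *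
      ∏ k ∈ Finset.range N, (1 - (qq τ) ^ (k + 1) * cexp (-(2 * Real.pi * I * z))) =
      ∑' n : ℤ, fTerm τ z N n := by
  rw [finite_triple]
  have hinj : Function.Injective (fun j : ℕ => (j : ℤ) - N) := fun a b h => by
    simp only at h; omega
  rw [← hinj.tsum_eq (f := fTerm τ z N)]
  · rw [tsum_eq_sum (s := Finset.range (N + 1 + N + 1))]
    · refine Finset.sum_congr rfl fun j _ => ?_
      simp [fTerm]
    · intro j hj
      have hj' : N + 1 + N < j := by simpa using hj
      simp [fTerm, gaussB_gt _ _ _ hj']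
  · intro n hn
    have : 0 ≤ n + N := by
      by_contra h
      exact hn (by simp [fTerm, h])
    exact ⟨(n + N).toNat, by simp only; omega⟩

lemma triple_limit (τ z : ℂ) (hτ : 0 < τ.im) : ∃ L : ℂ, L ≠ 0 ∧
    Tendsto (qFac (qq τ)) atTop (𝓝 L) ∧
    Tendsto (fun N => ∑' n : ℤ, fTerm τ z N n) atTop
      (𝓝 (∑' n : ℤ, L⁻¹ * tTerm τ z n)) := by
  have hq := norm_qq τ hτ
  obtain ⟨L, hL, hT⟩ := qFac_tendsto hq
  obtain ⟨C, hC, hb⟩ := gaussB_bound hq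
  have hs : Summable (tTerm τ z) := (summable_jacobiTheta₂_term_iff _ τ).2 hτ
  refine ⟨L, hL, hT, tendsto_tsum_of_dominated_convergence (hs.norm.mul_left C) ?_ ?_⟩
  · intro n
    have t1 : Tendsto (fun N : ℕ => N + 1 + N) atTop atTop :=
      tendsto_atTop_mono (fun N => by simp only [id]; omega) tendsto_id
    have t2 : Tendsto (fun N : ℕ => (n + N).toNat) atTop atTop := by
      refine tendsto_atTop.2 fun b => ?_
      filter_upwards [eventually_ge_atTop (b + n.natAbs)] with N hN
      omega
    have t3 : Tendsto (fun N : ℕ => (N + 1 - n).toNat) atTop atTop := by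
      refine tendsto_atTop.2 fun b => ?_
      filter_upwards [eventually_ge_atTop (b + n.natAbs)] with N hN
      omega
    have := (((hT.comp t1).mul ((hT.comp t2).inv₀ hL)).mul ((hT.comp t3).inv₀ hL)).mul_const
      (tTerm τ z n)
    rw [mul_inv_cancel₀ hL, one_mul] at this
    refine this.congr' ?_
    filter_upwards [eventually_ge_atTop (n.natAbs)] with N hN
    have h0 : 0 ≤ n + N := by omega
    rw [fTerm, if_pos h0, gaussB_eq hq _ (n + N).toNat (N + 1 - n).toNat (by omega)]
    rfl
  · refine Eventually.of_forall fun N n => ?_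
    unfold fTerm
    split_ifs
    · rw [norm_mul]
      gcongr
      exact hb _ _
    · rw [norm_zero]; positivity

/-- Jacobi triple product. -/
lemma jTheta_eq (τ z : ℂ) (hτ : 0 < τ.im) :
    jTheta τ z = - cexp (Real.pi * I * τ / 4) * cexp (-(Real.pi * I * z)) *
      jacobiTheta₂ (z + 1 / 2 - τ / 2) τ := by
  have hq := norm_qq τ hτ
  obtain ⟨L, hL, hT, hlim⟩ := triple_limit τ z hτ
  rw [tsum_mul_left] at hlim
  have h1 := hlim.mul hT
  have hm : Multipliable (fun n : ℕ => (1 - (qq τ) ^ (n + 1) * (qq z)) *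
       (1 - (qq τ) ^ (n + 1) * cexp (-(2 * Real.pi * I * z))) * (1 - (qq τ) ^ (n + 1))) := by
    refine ((multipliable_aux hq _).mul (multipliable_aux hq _)).mul ?_
    simpa using multipliable_aux hq 1
  have h2 := hm.tendsto_prod_tprod_nat.const_mul (1 - (qq z))
  have h3 := tendsto_nhds_unique h2 (h1.congr fun N => by
    rw [← finite_tsum, Finset.prod_range_succ', Finset.prod_mul_distrib, Finset.prod_mul_distrib,
      qFac]
    ring)
  have h4 : (1 - (qq z)) * ∏' n : ℕ, ((1 - (qq τ) ^ (n + 1) * (qq z)) *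
       (1 - (qq τ) ^ (n + 1) * cexp (-(2 * Real.pi * I * z))) * (1 - (qq τ) ^ (n + 1))) =
       jacobiTheta₂ (z + 1 / 2 - τ / 2) τ := by
    rw [h3]
    change L⁻¹ * jacobiTheta₂ (z + 1 / 2 - τ / 2) τ * L = _
    field_simp
  rw [← h4, jTheta]
  have h5 : cexp (Real.pi * I * z) - cexp (-(Real.pi * I * z)) =
      - cexp (-(Real.pi * I * z)) * (1 - (qq z)) := by
    rw [mul_sub, mul_one, neg_mul, ← Complex.exp_add,
      show -(Real.pi * I * z) + 2 * Real.pi * I * z = Real.pi * I * z by ring]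
    ring
  rw [h5]
  ring

noncomputable def oddTerm (τ z : ℂ) (i : ℤ) : ℂ :=
  cexp (Real.pi * I * τ / 2 + 2 * Real.pi * I * z) * jacobiTheta₂_term i (2 * z + τ) (2 * τ)

noncomputable def evenTerm (τ z : ℂ) (i : ℤ) : ℂ := jacobiTheta₂_term i (2 * z) (2 * τ)

lemma exp_int_pi (n : ℤ) : cexp (2 * Real.pi * I * n) = 1 := by
  rw [Complex.exp_eq_one_iff]; exact ⟨n, by ring⟩

lemma term_odd_even (τ x y : ℂ) (i j : ℤ) :
    cexp (Real.pi * I * τ / 2 - 2 * Real.pi * I * x) *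
      (jacobiTheta₂_term (i + j + 1) (x + y + 1 / 2 - τ / 2) τ *
        jacobiTheta₂_term (i - j + 1) (x - y + 1 / 2 - τ / 2) τ) =
    oddTerm τ x i * evenTerm τ y j := by
  unfold oddTerm evenTerm jacobiTheta₂_term
  rw [← Complex.exp_add, ← Complex.exp_add, ← Complex.exp_add, ← Complex.exp_add,
    Complex.exp_eq_exp_iff_exists_int]
  refine ⟨i + 1, ?_⟩
  push_cast
  ring

lemma term_even_odd (τ x y : ℂ) (i j : ℤ) :
    cexp (Real.pi * I * τ / 2 - 2 * Real.pi * I * x) *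
      (jacobiTheta₂_term (i + j + 1) (x + y + 1 / 2 - τ / 2) τ *
        jacobiTheta₂_term (i - j) (x - y + 1 / 2 - τ / 2) τ) =
    - (evenTerm τ x i * oddTerm τ y j) := by
  unfold oddTerm evenTerm jacobiTheta₂_term
  have h : cexp (Real.pi * I * (2 * i + 1)) = -1 := by
    rw [show (Real.pi * I * (2 * i + 1) : ℂ) = 2 * Real.pi * I * i + Real.pi * I by ring,
      Complex.exp_add, exp_int_pi, Complex.exp_pi_mul_I, one_mul]
  rw [neg_eq_neg_one_mul, ← h, ← Complex.exp_add, ← Complex.exp_add, ← Complex.exp_add,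
    ← Complex.exp_add, ← Complex.exp_add]
  congr 1
  push_cast
  ring

/-- Splitting of the lattice by parity. -/
noncomputable def latticeEquiv : (ℤ × ℤ) ⊕ (ℤ × ℤ) ≃ ℤ × ℤ :=
  Equiv.ofBijective
    (Sum.elim (fun p => (p.1 + p.2 + 1, p.1 - p.2 + 1)) (fun p => (p.1 + p.2 + 1, p.1 - p.2))) (by
    constructor
    · rintro (⟨a, b⟩ | ⟨a, b⟩) (⟨c, d⟩ | ⟨c, d⟩) h <;>
        simp only [Sum.elim_inl, Sum.elim_inr, Prod.mk.injEq] at h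
      · obtain ⟨h1, h2⟩ := h
        have : a = c := by omega
        have : b = d := by omega
        simp [*]
      · omega
      · omega
      · obtain ⟨h1, h2⟩ := h
        have : a = c := by omega
        have : b = d := by omega
        simp [*]
    · rintro ⟨m, n⟩
      rcases Int.even_or_odd' (m + n) with ⟨k, hk | hk⟩
      · refine ⟨Sum.inl (k - 1, m - k), ?_⟩
        simp only [Sum.elim_inl, Prod.mk.injEq]
        omega
      · refine ⟨Sum.inr (k, m - k - 1), ?_⟩
        simp only [Sum.elim_inr, Prod.mk.injEq]
        omega)

lemma summable_odd (τ z : ℂ) (hτ : 0 < τ.im) : Summable (oddTerm τ z) :=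
  ((summable_jacobiTheta₂_term_iff _ _).2 (by simpa using hτ)).mul_left _

lemma summable_even (τ z : ℂ) (hτ : 0 < τ.im) : Summable (evenTerm τ z) :=
  (summable_jacobiTheta₂_term_iff _ _).2 (by simpa using hτ)

lemma theta_det (τ x y : ℂ) (hτ : 0 < τ.im) :
    cexp (Real.pi * I * τ / 2 - 2 * Real.pi * I * x) *
      (jacobiTheta₂ (x + y + 1 / 2 - τ / 2) τ * jacobiTheta₂ (x - y + 1 / 2 - τ / 2) τ) =
    (∑' i, oddTerm τ x i) * (∑' i, evenTerm τ y i) -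
      (∑' i, evenTerm τ x i) * (∑' i, oddTerm τ y i) := by
  have s1 := (summable_jacobiTheta₂_term_iff (x + y + 1 / 2 - τ / 2) τ).2 hτ
  have s2 := (summable_jacobiTheta₂_term_iff (x - y + 1 / 2 - τ / 2) τ).2 hτ
  unfold jacobiTheta₂
  rw [tsum_mul_tsum_of_summable_norm s1.norm s2.norm, ← tsum_mul_left,
    tsum_mul_tsum_of_summable_norm (summable_odd τ x hτ).norm (summable_even τ y hτ).norm,
    tsum_mul_tsum_of_summable_norm (summable_even τ x hτ).norm (summable_odd τ y hτ).norm]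
  have so := summable_mul_of_summable_norm (summable_odd τ x hτ).norm (summable_even τ y hτ).norm
  have se := summable_mul_of_summable_norm (summable_even τ x hτ).norm (summable_odd τ y hτ).norm
  rw [← latticeEquiv.tsum_eq, sub_eq_add_neg (∑' z : ℤ × ℤ, _)]
  refine HasSum.tsum_eq (HasSum.sum ?_ ?_)
  · convert so.hasSum using 1
    funext p
    exact term_odd_even τ x y p.1 p.2
  · have hn := se.hasSum.neg
    refine (congrArg (fun f => HasSum f _) (funext fun p => ?_)).mpr hn
    exact term_even_odd τ x y p.1 p.2

lemma jTheta_mul (τ x y u v : ℂ) (hτ : 0 < τ.im) (hu : u = x + y) (hv : v = x - y) :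
    jTheta τ u * jTheta τ v =
    (∑' i, oddTerm τ x i) * (∑' i, evenTerm τ y i) -
      (∑' i, evenTerm τ x i) * (∑' i, oddTerm τ y i) := by
  rw [← theta_det τ x y hτ, hu, hv, jTheta_eq τ _ hτ, jTheta_eq τ _ hτ]
  have h : cexp (Real.pi * I * τ / 2 - 2 * Real.pi * I * x) =
      cexp (Real.pi * I * τ / 4) * cexp (-(Real.pi * I * (x + y))) *
      (cexp (Real.pi * I * τ / 4) * cexp (-(Real.pi * I * (x - y)))) := by
    rw [← Complex.exp_add, ← Complex.exp_add, ← Complex.exp_add]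
    congr 1
    ring
  rw [h]
  ring

/-- Riemann theta relation, variant (R₅). -/
theorem riemann_theta_relation_R5 (τ : ℂ) (hτ : 0 < τ.im) (z₁ z₂ z₃ z₄ : ℂ) :
    jTheta τ z₁ * jTheta τ z₂ * jTheta τ z₃ * jTheta τ z₄ +
      jTheta τ ((z₁ + z₂ + z₃ - z₄) / 2) * jTheta τ ((z₁ + z₂ - z₃ + z₄) / 2) *
        jTheta τ ((z₁ - z₂ + z₃ + z₄) / 2) * jTheta τ ((z₁ - z₂ - z₃ - z₄) / 2) =
      jTheta τ ((z₁ + z₂ + z₃ + z₄) / 2) * jTheta τ ((z₁ + z₂ - z₃ - z₄) / 2) *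
        jTheta τ ((z₁ - z₂ + z₃ - z₄) / 2) * jTheta τ ((z₁ - z₂ - z₃ + z₄) / 2) := by
  have hx := jTheta_mul τ ((z₁ + z₂) / 2) ((z₁ - z₂) / 2) z₁ z₂ hτ (by ring) (by ring)
  have hu := jTheta_mul τ ((z₃ + z₄) / 2) ((z₃ - z₄) / 2) z₃ z₄ hτ (by ring) (by ring)
  have p12 := jTheta_mul τ ((z₁ + z₂) / 2) ((z₃ + z₄) / 2) ((z₁ + z₂ + z₃ + z₄) / 2)
    ((z₁ + z₂ - z₃ - z₄) / 2) hτ (by ring) (by ring)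
  have p34 := jTheta_mul τ ((z₁ - z₂) / 2) ((z₃ - z₄) / 2) ((z₁ - z₂ + z₃ - z₄) / 2)
    ((z₁ - z₂ - z₃ + z₄) / 2) hτ (by ring) (by ring)
  have m12 := jTheta_mul τ ((z₁ + z₂) / 2) ((z₃ - z₄) / 2) ((z₁ + z₂ + z₃ - z₄) / 2)
    ((z₁ + z₂ - z₃ + z₄) / 2) hτ (by ring) (by ring)
  have m34 := jTheta_mul τ ((z₁ - z₂) / 2) ((z₃ + z₄) / 2) ((z₁ - z₂ + z₃ + z₄) / 2)
    ((z₁ - z₂ - z₃ - z₄) / 2) hτ (by ring) (by ring)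
  rw [mul_assoc (jTheta τ z₁ * jTheta τ z₂), hx, hu,
    mul_assoc (jTheta τ _ * jTheta τ _), m12, m34,
    mul_assoc (jTheta τ _ * jTheta τ _), p12, p34]
  ring
end

section
/- (Theta-block identity for the lattice L₆) For every τ ∈ ℍ and all z₁, …, z₆ ∈ ℂ, writing ϑ(w) for ϑ(τ,w), one has η(τ)^{−3}·ϑ(z₃)ϑ(z₄)ϑ(z₃−z₄)ϑ(z₂−z₆)ϑ(z₂+z₆)ϑ(2z₁+z₂−z₅)ϑ(z₅+z₆)ϑ(z₂)ϑ(z₆) = η(τ)^{−3}·ϑ(z₃)ϑ(z₄)ϑ(z₃−z₄)ϑ(z₂−z₆)ϑ(z₂+z₆)ϑ(z₁)ϑ(z₁+z₂+z₆)ϑ(z₁−z₅)ϑ(z₁+z₂−z₅−z₆) − η(τ)^{−3}·ϑ(z₃)ϑ(z₄)ϑ(z₃−z₄)ϑ(z₂−z₆)ϑ(z₂+z₆)ϑ(z₁−z₅−z₆)ϑ(z₁+z₂−z₅)ϑ(z₁+z₂)ϑ(z₁+z₆). -/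
open Complex

/-- The Dedekind eta function `η(τ) = e^{πiτ/12} ∏_{n≥1} (1 − e^{2πinτ})`. -/
noncomputable def dedekindEta (τ : ℂ) : ℂ :=
  Complex.exp (Real.pi * Complex.I * τ / 12) *
    ∏' n : ℕ, (1 - Complex.exp (2 * Real.pi * Complex.I * (n + 1) * τ))


lemma tb_shift {g : ℂ → ℂ} (hg : Differentiable ℂ g) (hper : ∀ z, g (z + 1) = g z) (w : ℂ) :
    ∫ x in (0:ℝ)..1, g (x + w) = ∫ x in (0:ℝ)..1, g x := by
  obtain ⟨F, hF⟩ := (hg.differentiableOn (s := Metric.ball 0 (‖w‖ + 3))).isExactOn_ball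
  have hball : ∀ (x : ℝ) (v : ℂ), 0 ≤ x → x ≤ 1 → ‖v‖ < ‖w‖ + 1 →
      (x : ℂ) + v ∈ Metric.ball (0:ℂ) (‖w‖ + 3) := by
    intro x v h0 h1 hv
    rw [mem_ball_zero_iff]
    have := norm_add_le (x : ℂ) v
    rw [Complex.norm_real, Real.norm_of_nonneg h0] at this
    linarith
  have key : ∀ v : ℂ, ‖v‖ < ‖w‖ + 1 → ∫ x in (0:ℝ)..1, g (x + v) = F (1 + v) - F v := by
    intro v hv
    have := intervalIntegral.integral_eq_sub_of_hasDerivAt (a := 0) (b := 1)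
      (f := fun x : ℝ => F (x + v)) (f' := fun x : ℝ => g (x + v)) ?_ ?_
    · simpa using this
    · intro x hx
      rw [Set.uIcc_of_le zero_le_one] at hx
      exact ((hF _ (hball x v hx.1 hx.2 hv)).comp_add_const (x : ℂ) v).comp_ofReal
    · apply Continuous.intervalIntegrable
      have := hg.continuous
      fun_prop
  have hw := key w (by linarith)
  have h0 := key 0 (by rw [norm_zero]; positivity)
  simp only [add_zero] at h0
  rw [hw, h0]
  have hd : ∀ v ∈ Metric.ball (0:ℂ) (‖w‖ + 1),
      HasDerivWithinAt (fun v => F (1 + v) - F v) 0 (Metric.ball (0:ℂ) (‖w‖ + 1)) v := by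
    intro v hv
    rw [mem_ball_zero_iff] at hv
    have h1 := (hF _ (hball 1 v zero_le_one le_rfl hv))
    have h2 := (hF _ (hball 0 v le_rfl zero_le_one hv))
    simp only [ofReal_one, ofReal_zero, zero_add] at h1 h2
    have h3 := (h1.comp_const_add 1 v).sub h2
    rw [add_comm, hper, sub_self] at h3
    exact h3.hasDerivWithinAt
  have := (convex_ball (0:ℂ) (‖w‖ + 1)).norm_image_sub_le_of_norm_hasDerivWithin_le (C := 0) hd
    (by simp) (x := 0) (y := w) (by simp; positivity) (by simp)
  simp only [zero_mul, norm_le_zero_iff, sub_eq_zero, add_zero] at this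
  exact this

lemma tb_fourier {f : ℝ → ℂ} (hf : Continuous f) (hper : ∀ x, f (x + 1) = f x)
    (h : ∀ n : ℤ, ∫ x in (0:ℝ)..1, cexp (-(2 * Real.pi * I * n * x)) * f x = 0) (x : ℝ) :
    f x = 0 := by
  have hp : Function.Periodic f (1:ℝ) := hper
  let F : C(AddCircle (1:ℝ), ℂ) := ⟨hp.lift, by
    exact continuous_coinduced_dom.mpr hf⟩
  have : Fact ((0:ℝ) < 1) := ⟨one_pos⟩
  have hc : fourierCoeff F = 0 := by
    funext n
    rw [fourierCoeff_eq_intervalIntegral _ n 0]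
    simp only [one_div, inv_one, one_smul, zero_add, Pi.zero_apply]
    rw [← h n]
    congr 1
    funext x
    rw [fourier_coe_apply]
    show _ * hp.lift x = _
    rw [Function.Periodic.lift_coe]
    congr 2
    push_cast
    ring
  have := has_pointwise_sum_fourier_series_of_summable (f := F) (by rw [hc]; exact summable_zero) (x : AddCircle (1:ℝ))
  rw [hc] at this
  simp only [Pi.zero_apply, zero_smul] at this
  have h2 := this.unique hasSum_zero
  exact h2

/-- entire functions with degree-two quasi-periodicity -/
structure TBq (τ c : ℂ) (f : ℂ → ℂ) : Prop where
  diff : Differentiable ℂ f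
  per : ∀ z, f (z + 1) = f z
  quasi : ∀ z, f (z + τ) = c * cexp (-(4 * Real.pi * I * z)) * f z

noncomputable def tbCoeff (f : ℂ → ℂ) (n : ℤ) : ℂ :=
  ∫ x in (0:ℝ)..1, cexp (-(2 * Real.pi * I * n * x)) * f x

lemma tb_coeff_rec {τ c : ℂ} {f : ℂ → ℂ} (h : TBq τ c f) (n : ℤ) :
    c * cexp (-(2 * Real.pi * I * n * τ)) * tbCoeff f (n + 2) = tbCoeff f n := by
  have := tb_shift (g := fun z => cexp (-(2 * Real.pi * I * n * z)) * f z)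
    (by have := h.diff; fun_prop) (by
      intro z
      rw [h.per]
      congr 1
      rw [Complex.exp_eq_exp_iff_exists_int]
      exact ⟨-n, by push_cast; ring⟩) τ
  rw [tbCoeff, tbCoeff, ← this, ← intervalIntegral.integral_const_mul]
  congr 1
  funext x
  rw [h.quasi]
  have : cexp (-(2 * Real.pi * I * n * (x + τ))) * cexp (-(4 * Real.pi * I * x)) =
     cexp (-(2 * Real.pi * I * n * τ)) * cexp (-(2 * Real.pi * I * (n + 2 : ℤ) * x)) := by
    rw [← Complex.exp_add, ← Complex.exp_add]
    congr 1
    push_cast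
    ring
  linear_combination (-(c * f x)) * this

lemma tb_zero {τ c : ℂ} (hc : c ≠ 0) {f : ℂ → ℂ} (h : TBq τ c f) (h0 : tbCoeff f 0 = 0)
    (h1 : tbCoeff f 1 = 0) (z : ℂ) : f z = 0 := by
  have hup : ∀ n : ℤ, tbCoeff f n = 0 ↔ tbCoeff f (n + 2) = 0 := by
    intro n
    rw [← tb_coeff_rec h n]
    simp [hc]
  have hpos : ∀ n : ℕ, tbCoeff f n = 0 ∧ tbCoeff f (n + 1) = 0 := by
    intro n
    induction n with
    | zero => simpa using ⟨h0, h1⟩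
    | succ n ih =>
      push_cast
      exact ⟨ih.2, by rw [add_assoc]; exact (hup n).1 ih.1⟩
  have hneg : ∀ n : ℕ, tbCoeff f (-n) = 0 ∧ tbCoeff f (-n + 1) = 0 := by
    intro n
    induction n with
    | zero => simpa using ⟨h0, h1⟩
    | succ n ih =>
      push_cast
      refine ⟨(hup _).2 ?_, ?_⟩
      · convert ih.2 using 2; ring
      · convert ih.1 using 2; ring
  have hall : ∀ n : ℤ, tbCoeff f n = 0 := by
    intro n
    obtain ⟨k, rfl | rfl⟩ := n.eq_nat_or_neg
    · exact (hpos k).1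
    · exact (hneg k).1
  have hreal : ∀ x : ℝ, f x = 0 := by
    apply tb_fourier (f := fun x : ℝ => f x)
    · have := h.diff.continuous
      fun_prop
    · intro x
      push_cast
      exact h.per x
    · exact hall
  have han : AnalyticOnNhd ℂ f Set.univ := fun z _ => h.diff.analyticAt z
  have := han.eqOn_zero_of_preconnected_of_frequently_eq_zero isPreconnected_univ
    (Set.mem_univ (0:ℂ)) ?_
  · exact this (Set.mem_univ z)
  · have ht : Filter.Tendsto (fun x : ℝ => (x : ℂ)) (nhdsWithin 0 {0}ᶜ) (nhdsWithin 0 {0}ᶜ) := by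
      apply tendsto_nhdsWithin_of_tendsto_nhds_of_eventually_within
      · have : Filter.Tendsto (fun x : ℝ => (x : ℂ)) (nhds 0) (nhds ((0:ℝ):ℂ)) :=
          Complex.continuous_ofReal.tendsto 0
        simpa using this.mono_left nhdsWithin_le_nhds
      · filter_upwards [self_mem_nhdsWithin] with x hx
        simpa using hx
    exact ht.frequently (Filter.Frequently.of_forall hreal)

lemma tb_coeff_lin {τ c : ℂ} {f g k : ℂ → ℂ} (hf : TBq τ c f) (hg : TBq τ c g) (hk : TBq τ c k)
    (α β γ : ℂ) (n : ℤ) : tbCoeff (fun z => α * f z + β * g z + γ * k z) n =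
      α * tbCoeff f n + β * tbCoeff g n + γ * tbCoeff k n := by
  have c1 := hf.diff.continuous
  have c2 := hg.diff.continuous
  have c3 := hk.diff.continuous
  unfold tbCoeff
  rw [← intervalIntegral.integral_const_mul, ← intervalIntegral.integral_const_mul,
    ← intervalIntegral.integral_const_mul, ← intervalIntegral.integral_add,
    ← intervalIntegral.integral_add]
  · congr 1
    funext x
    ring
  all_goals
    apply Continuous.intervalIntegrable
    fun_prop

lemma tb_dep {τ c : ℂ} (hc : c ≠ 0) {f g k : ℂ → ℂ} (hf : TBq τ c f) (hg : TBq τ c g)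
    (hk : TBq τ c k) : ∃ α β γ : ℂ, (α ≠ 0 ∨ β ≠ 0 ∨ γ ≠ 0) ∧
      ∀ z, α * f z + β * g z + γ * k z = 0 := by
  have main : ∀ α β γ : ℂ, α * tbCoeff f 0 + β * tbCoeff g 0 + γ * tbCoeff k 0 = 0 →
      α * tbCoeff f 1 + β * tbCoeff g 1 + γ * tbCoeff k 1 = 0 →
      ∀ z, α * f z + β * g z + γ * k z = 0 := by
    intro α β γ h0 h1
    refine tb_zero (τ := τ) hc (f := fun z => α * f z + β * g z + γ * k z) ⟨?_, ?_, ?_⟩ ?_ ?_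
    · have := hf.diff
      have := hg.diff
      have := hk.diff
      fun_prop
    · intro z
      simp only [hf.per, hg.per, hk.per]
    · intro z
      simp only [hf.quasi, hg.quasi, hk.quasi]
      ring
    · rw [tb_coeff_lin hf hg hk, h0]
    · rw [tb_coeff_lin hf hg hk, h1]
  obtain ⟨v, hv, hv0⟩ := Matrix.exists_mulVec_eq_zero_iff.2 (show
    (!![tbCoeff f 0, tbCoeff g 0, tbCoeff k 0; tbCoeff f 1, tbCoeff g 1, tbCoeff k 1; 0, 0, 0] :
      Matrix (Fin 3) (Fin 3) ℂ).det = 0 by simp [Matrix.det_fin_three])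
  refine ⟨v 0, v 1, v 2, ?_, main _ _ _ ?_ ?_⟩
  · by_contra! hcon
    apply hv
    funext i
    fin_cases i
    · exact hcon.1
    · exact hcon.2.1
    · exact hcon.2.2
  · have := congrFun hv0 0
    simp [Matrix.mulVec, dotProduct, Fin.sum_univ_three] at this
    linear_combination this
  · have := congrFun hv0 1
    simp [Matrix.mulVec, dotProduct, Fin.sum_univ_three] at this
    linear_combination this

lemma tb_weierstrass {τ s : ℂ} (hs : s ≠ 0) {θ : ℂ → ℂ} (hd : Differentiable ℂ θ)
    (h1 : ∀ z, θ (z + 1) = - θ z) (hodd : ∀ z, θ (-z) = - θ z)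
    (hq : ∀ z, θ (z + τ) = s * cexp (-(2 * Real.pi * I * z)) * θ z) (x y u v : ℂ) :
    θ (x + y) * θ (x - y) * (θ (u + v) * θ (u - v)) +
    θ (x + u) * θ (x - u) * (θ (v + y) * θ (v - y)) +
    θ (x + v) * θ (x - v) * (θ (y + u) * θ (y - u)) = 0 := by
  have hq2 : ∀ y, TBq τ (s ^ 2) (fun x => θ (x + y) * θ (x - y)) := by
    intro y
    refine ⟨by fun_prop, ?_, ?_⟩
    · intro z
      rw [show z + 1 + y = z + y + 1 by ring, show z + 1 - y = z - y + 1 by ring, h1, h1]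
      ring
    · intro z
      rw [show z + τ + y = z + y + τ by ring, show z + τ - y = z - y + τ by ring, hq, hq]
      have : cexp (-(4 * Real.pi * I * z)) =
          cexp (-(2 * Real.pi * I * (z + y))) * cexp (-(2 * Real.pi * I * (z - y))) := by
        rw [← Complex.exp_add]
        congr 1
        ring
      rw [this]
      ring
  have hθ0 : θ 0 = 0 := by
    have := hodd 0
    rw [neg_zero] at this
    linear_combination this / 2
  have swap : ∀ a b, θ (a + b) * θ (a - b) = - (θ (b + a) * θ (b - a)) := by
    intro a b
    rw [← neg_sub b a, hodd, add_comm a b]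
    ring
  obtain ⟨α, β, γ, hne, h⟩ := tb_dep (pow_ne_zero 2 hs) (hq2 y) (hq2 u) (hq2 v)
  have ey := h y
  have eu := h u
  have ev := h v
  have ex := h x
  simp only [sub_self, hθ0, mul_zero, add_zero, zero_add] at ey eu ev
  rw [swap y v] at ey
  rw [swap u y] at eu
  rw [swap v u] at ev
  generalize θ (u + v) * θ (u - v) = A at *
  generalize θ (v + y) * θ (v - y) = B at *
  generalize θ (y + u) * θ (y - u) = C at *
  generalize θ (x + y) * θ (x - y) = X at *
  generalize θ (x + u) * θ (x - u) = Y at *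
  generalize θ (x + v) * θ (x - v) = Z at *
  rcases hne with hne | hne | hne <;> apply mul_left_cancel₀ hne
  · linear_combination A * ex + Y * ev - Z * eu
  · linear_combination B * ex - X * ev + Z * ey
  · linear_combination C * ex + X * eu - Y * ey

noncomputable def tbP (q w : ℂ) : ℂ := ∏' n : ℕ, (1 - q ^ (n + 1) * w)

lemma tb_mult {q : ℂ} (hq : ‖q‖ < 1) (w : ℂ) : Multipliable fun n : ℕ => (1 - q ^ (n + 1) * w) := by
  apply multipliable_one_add_of_summable (f := fun n ↦ -(q ^ (n + 1) * w))
  simpa using ((summable_nat_add_iff 1).mpr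
    (summable_geometric_of_lt_one (norm_nonneg _) hq)).mul_right ‖w‖

lemma tbP_rec {q : ℂ} (hq : ‖q‖ < 1) (w : ℂ) : tbP q w = (1 - q * w) * tbP q (q * w) := by
  unfold tbP
  have e : ∀ n : ℕ, 1 - q ^ (n + 1) * (q * w) = 1 - q ^ (n + 1 + 1) * w := by intro n; ring
  rw [tprod_eq_zero_mul' (f := fun n : ℕ => (1 - q ^ (n + 1) * w))]
  · simp only [e, zero_add, pow_one]
  · simp only [← e]
    exact tb_mult hq _

lemma tbP_diff {q : ℂ} (hq : ‖q‖ < 1) : Differentiable ℂ (tbP q) := by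
  intro w
  have hsum : Summable fun n : ℕ => ‖q‖ ^ (n + 1) * (‖w‖ + 1) :=
    ((summable_nat_add_iff 1).mpr
      (summable_geometric_of_lt_one (norm_nonneg _) hq)).mul_right _
  have hl := hsum.hasProdLocallyUniformlyOn_nat_one_add (K := Metric.ball (0:ℂ) (‖w‖ + 1))
    (f := fun n w => -(q ^ (n + 1) * w)) Metric.isOpen_ball
    (.of_forall fun n x hx => by
      rw [mem_ball_zero_iff] at hx
      rw [norm_neg, norm_mul, norm_pow]
      gcongr) (fun _ => by fun_prop)
  have := hl.differentiableOn
    (.of_forall fun _ ↦ by simpa [Finset.prod_fn] using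
      DifferentiableOn.finsetProd (fun _ _ ↦ by fun_prop)) Metric.isOpen_ball
  have h2 := this.differentiableAt (Metric.isOpen_ball.mem_nhds (x := w) (by simp))
  exact h2

lemma tb_norm_lt {τ : ℂ} (hτ : 0 < τ.im) : ‖cexp (2 * Real.pi * I * τ)‖ < 1 := by
  rw [Complex.norm_exp, Real.exp_lt_one_iff]
  have := mul_pos Real.pi_pos hτ
  simp
  linarith

lemma tb_theta_eq {τ : ℂ} (hτ : 0 < τ.im) (z : ℂ) :
    jTheta τ z = cexp (Real.pi * I * τ / 4) * tbP (cexp (2 * Real.pi * I * τ)) 1 *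
      ((cexp (Real.pi * I * z) - cexp (-(Real.pi * I * z))) *
      tbP (cexp (2 * Real.pi * I * τ)) (cexp (2 * Real.pi * I * z)) *
      tbP (cexp (2 * Real.pi * I * τ)) (cexp (-(2 * Real.pi * I * z)))) := by
  have hq := tb_norm_lt hτ
  unfold jTheta
  have h1 := tb_mult hq (cexp (2 * Real.pi * I * z))
  have h2 := tb_mult hq (cexp (-(2 * Real.pi * I * z)))
  have h3 := tb_mult hq 1
  simp only [mul_one] at h3
  rw [(h1.mul h2).tprod_mul h3, h1.tprod_mul h2]
  simp only [tbP, mul_one]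
  ring

lemma tb_theta_diff {τ : ℂ} (hτ : 0 < τ.im) : Differentiable ℂ (jTheta τ) := by
  have h := tbP_diff (tb_norm_lt hτ)
  rw [funext (tb_theta_eq hτ)]
  fun_prop

lemma tb_theta_odd {τ : ℂ} (hτ : 0 < τ.im) (z : ℂ) : jTheta τ (-z) = - jTheta τ z := by
  rw [tb_theta_eq hτ, tb_theta_eq hτ]
  simp only [mul_neg, neg_neg]
  ring

lemma tb_theta_one {τ : ℂ} (hτ : 0 < τ.im) (z : ℂ) : jTheta τ (z + 1) = - jTheta τ z := by
  rw [tb_theta_eq hτ, tb_theta_eq hτ]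
  have e1 : cexp (2 * Real.pi * I * (z + 1)) = cexp (2 * Real.pi * I * z) := by
    rw [mul_add, mul_one, Complex.exp_add, Complex.exp_two_pi_mul_I, mul_one]
  have e2 : cexp (-(2 * Real.pi * I * (z + 1))) = cexp (-(2 * Real.pi * I * z)) := by
    rw [Complex.exp_neg, e1, Complex.exp_neg]
  have e3 : cexp (Real.pi * I * (z + 1)) = - cexp (Real.pi * I * z) := by
    rw [mul_add, mul_one, Complex.exp_add, Complex.exp_pi_mul_I]; ring
  have e4 : cexp (-(Real.pi * I * (z + 1))) = - cexp (-(Real.pi * I * z)) := by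
    rw [Complex.exp_neg, e3, Complex.exp_neg, inv_neg]
  rw [e1, e2, e3, e4]
  ring

lemma tb_theta_tau {τ : ℂ} (hτ : 0 < τ.im) (z : ℂ) : jTheta τ (z + τ) =
    -(cexp (Real.pi * I * τ))⁻¹ * cexp (-(2 * Real.pi * I * z)) * jTheta τ z := by
  have hq := tb_norm_lt hτ
  rw [tb_theta_eq hτ, tb_theta_eq hτ]
  generalize cexp (Real.pi * I * τ / 4) * tbP (cexp (2 * Real.pi * I * τ)) 1 = K
  have a1 : cexp (2 * Real.pi * I * τ) = cexp (Real.pi * I * τ) ^ 2 := by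
    rw [← Complex.exp_nat_mul]; congr 1; push_cast; ring
  have a2 : ∀ z : ℂ, cexp (2 * Real.pi * I * z) = cexp (Real.pi * I * z) ^ 2 := by
    intro z
    rw [← Complex.exp_nat_mul]; congr 1; push_cast; ring
  have a3 : cexp (Real.pi * I * (z + τ)) = cexp (Real.pi * I * z) * cexp (Real.pi * I * τ) := by
    rw [← Complex.exp_add]; congr 1; ring
  simp only [Complex.exp_neg, a2, a3] at hq ⊢
  have hs := Complex.exp_ne_zero (Real.pi * I * τ)
  have hv := Complex.exp_ne_zero (Real.pi * I * z)
  generalize cexp (Real.pi * I * τ) = s at *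
  generalize cexp (Real.pi * I * z) = v at *
  have r1 := tbP_rec hq (v ^ 2)
  have r2 := tbP_rec hq ((v * s) ^ 2)⁻¹
  rw [show s ^ 2 * ((v * s) ^ 2)⁻¹ = (v ^ 2)⁻¹ by field_simp] at r2
  rw [r1, r2, show (v * s) ^ 2 = s ^ 2 * v ^ 2 by ring]
  generalize tbP (s ^ 2) (s ^ 2 * v ^ 2) = A
  generalize tbP (s ^ 2) (v ^ 2)⁻¹ = B
  field_simp
  ring

/-- Theta-block identity for the lattice `L₆`. -/
theorem theta_block_identity_L6 (τ : ℂ) (hτ : 0 < τ.im) (z₁ z₂ z₃ z₄ z₅ z₆ : ℂ) :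
    dedekindEta τ ^ (-3 : ℤ) *
      (jTheta τ z₃ * jTheta τ z₄ * jTheta τ (z₃ - z₄) * jTheta τ (z₂ - z₆) *
        jTheta τ (z₂ + z₆) * jTheta τ (2 * z₁ + z₂ - z₅) * jTheta τ (z₅ + z₆) *
        jTheta τ z₂ * jTheta τ z₆) =
    dedekindEta τ ^ (-3 : ℤ) *
      (jTheta τ z₃ * jTheta τ z₄ * jTheta τ (z₃ - z₄) * jTheta τ (z₂ - z₆) *
        jTheta τ (z₂ + z₆) * jTheta τ z₁ * jTheta τ (z₁ + z₂ + z₆) *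
        jTheta τ (z₁ - z₅) * jTheta τ (z₁ + z₂ - z₅ - z₆)) -
    dedekindEta τ ^ (-3 : ℤ) *
      (jTheta τ z₃ * jTheta τ z₄ * jTheta τ (z₃ - z₄) * jTheta τ (z₂ - z₆) *
        jTheta τ (z₂ + z₆) * jTheta τ (z₁ - z₅ - z₆) * jTheta τ (z₁ + z₂ - z₅) *
        jTheta τ (z₁ + z₂) * jTheta τ (z₁ + z₆)) := by
  have hw := tb_weierstrass (τ := τ) (θ := jTheta τ)
    (neg_ne_zero.2 (inv_ne_zero (Complex.exp_ne_zero (Real.pi * I * τ))))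
    (tb_theta_diff hτ) (tb_theta_one hτ) (tb_theta_odd hτ) (tb_theta_tau hτ)
    ((2 * z₁ + z₂ + z₆) / 2) ((2 * z₁ + z₂ - 2 * z₅ - z₆) / 2) ((z₂ + z₆) / 2) ((z₂ - z₆) / 2)
  rw [← neg_sub ((2 * z₁ + z₂ - 2 * z₅ - z₆) / 2) ((z₂ - z₆) / 2), tb_theta_odd hτ] at hw
  ring_nf at hw ⊢
  linear_combination (dedekindEta τ ^ (-3 : ℤ) *
      (jTheta τ z₃ * jTheta τ z₄ * jTheta τ (z₃ - z₄) * jTheta τ (z₂ - z₆) *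
        jTheta τ (z₂ + z₆))) * hw
end

section
/- (Weight-2 theta-block decomposition) For every a = (a₁,a₂,a₃,a₄) ∈ ℤ⁴, every τ ∈ ℍ and every z ∈ ℂ, writing ϑ_c for ϑ(τ,cz), one has φ_{2,a}(τ,z) = φ^{(1)}_{2,a}(τ,z) − φ^{(2)}_{2,a}(τ,z), where φ^{(1)}_{2,a} = η^{−6}·ϑ_{a₁}ϑ_{a₂}ϑ_{a₂+a₃}ϑ_{a₂+2a₃+2a₄}ϑ_{a₁+a₂}ϑ_{a₂+a₃+2a₄}ϑ_{a₃}ϑ_{a₁−a₃}ϑ_{a₃+2a₄}ϑ_{a₁+a₂+a₃+2a₄} and φ^{(2)}_{2,a} = η^{−6}·ϑ_{a₁−a₃−a₄}ϑ_{a₂}ϑ_{a₂+a₃}ϑ_{a₂+2a₃+2a₄}ϑ_{a₁+a₂+a₃+a₄}ϑ_{a₂+a₃+2a₄}ϑ_{a₃}ϑ_{a₁+a₄}ϑ_{a₃+2a₄}ϑ_{a₁+a₂+a₄}. -/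
open Complex

/-- The weight-2 theta block `φ_{2,a}` attached to `a = (a₁,a₂,a₃,a₄) ∈ ℤ⁴`. -/
noncomputable def phi2 (a₁ a₂ a₃ a₄ : ℤ) (τ z : ℂ) : ℂ :=
  dedekindEta τ ^ (-6 : ℤ) *
    (jTheta τ (((2 * a₁ + a₂ + a₄ : ℤ) : ℂ) * z) * jTheta τ ((a₂ : ℂ) * z) *
      jTheta τ (((a₂ + a₃ : ℤ) : ℂ) * z) * jTheta τ (((a₂ + 2 * a₃ + 2 * a₄ : ℤ) : ℂ) * z) *
      jTheta τ (((a₂ + a₃ + a₄ : ℤ) : ℂ) * z) * jTheta τ (((a₂ + a₃ + 2 * a₄ : ℤ) : ℂ) * z) *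
      jTheta τ ((a₃ : ℂ) * z) * jTheta τ (((a₃ + a₄ : ℤ) : ℂ) * z) *
      jTheta τ (((a₃ + 2 * a₄ : ℤ) : ℂ) * z) * jTheta τ ((a₄ : ℂ) * z))

namespace TB

/-- `1/(q;q)_m`, extended by zero to negative integers. -/
noncomputable def R (q : ℂ) : ℤ → ℂ
  | Int.ofNat m => (∏ i ∈ Finset.range m, (1 - q ^ (i + 1)))⁻¹
  | Int.negSucc _ => 0

noncomputable def poch (q : ℂ) (m : ℕ) : ℂ := ∏ i ∈ Finset.range m, (1 - q ^ (i + 1))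

lemma one_sub_ne {q : ℂ} (hq : ‖q‖ < 1) (n : ℕ) : 1 - q ^ (n + 1) ≠ 0 := by
  intro h
  have h1 : q ^ (n + 1) = 1 := (sub_eq_zero.mp h).symm
  have h2 : ‖q‖ ^ (n + 1) = 1 := by rw [← norm_pow, h1, norm_one]
  have := pow_lt_one₀ (norm_nonneg q) hq (Nat.succ_ne_zero n)
  rw [Nat.succ_eq_add_one, h2] at this
  exact lt_irrefl _ this

lemma R_rec {q : ℂ} (hq : ‖q‖ < 1) (m : ℤ) : R q (m - 1) = (1 - q ^ m) * R q m := by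
  rcases m with m | m
  · rcases m with _ | m
    · simp [R]
      rfl
    · have : (Int.ofNat (m + 1) - 1) = Int.ofNat m := by simp
      rw [this]
      simp only [R, Finset.prod_range_succ]
      have h := one_sub_ne hq m
      have e : q ^ (Int.ofNat (m + 1)) = q ^ (m + 1) := zpow_natCast q (m + 1)
      rw [e, mul_inv]
      field_simp
  · have : Int.negSucc m - 1 = Int.negSucc (m + 1) := rfl
    rw [this]; simp [R]

lemma poch_eq (q : ℂ) (m : ℕ) : R q (m : ℤ) = (poch q m)⁻¹ := rfl

noncomputable def tri (q : ℂ) (j : ℤ) : ℂ := (-1) ^ j * q ^ (j * (j + 1) / 2)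

lemma tri_succ {q : ℂ} (h0 : q ≠ 0) (j : ℤ) : tri q (j + 1) = - (q * q ^ j) * tri q j := by
  unfold tri
  have : (j + 1) * (j + 1 + 1) / 2 = (j + 1) + j * (j + 1) / 2 := by
    rw [show (j + 1) * (j + 1 + 1) = j * (j + 1) + (j + 1) * 2 by ring,
      Int.add_mul_ediv_right _ _ (by norm_num)]
    ring
  rw [this, zpow_add₀ h0, zpow_add₀ h0, zpow_add₀ (by norm_num : (-1 : ℂ) ≠ 0)]
  simp
  ring

noncomputable def c (q : ℂ) (N : ℕ) (j : ℤ) : ℂ :=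
  tri q j * poch q (2 * N) * R q (N - j) * R q (N + j)

lemma c_rec {q : ℂ} (h0 : q ≠ 0) (hq : ‖q‖ < 1) (N : ℕ) (j : ℤ) :
    c q (N + 1) j = (1 + q ^ (2 * N + 1)) * c q N j - q ^ (N + 1) * c q N (j - 1)
      - q ^ N * c q N (j + 1) := by
  unfold c
  have e1 : poch q (2 * (N + 1)) = poch q (2 * N) * (1 - q ^ (2 * N + 1)) * (1 - q ^ (2 * N + 2)) := by
    rw [show 2 * (N + 1) = 2 * N + 1 + 1 by ring]
    unfold poch
    rw [Finset.prod_range_succ, Finset.prod_range_succ]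
  have hx : q ^ j ≠ 0 := zpow_ne_zero _ h0
  have t1 : tri q j = - (q ^ j) * tri q (j - 1) := by
    have := tri_succ h0 (j - 1)
    rw [sub_add_cancel, zpow_sub_one₀ h0] at this
    rw [this]; field_simp
  have t2 := tri_succ h0 j
  set A := R q (N + 1 - j) with hA
  set B := R q (N + 1 + j) with hB
  have a1 : R q (N - j) = (1 - q ^ N * q / q ^ j) * A := by
    have := R_rec hq (N + 1 - j)
    rw [show (N : ℤ) + 1 - j - 1 = N - j by ring] at this
    rw [this, zpow_sub₀ h0, zpow_add₀ h0]; simp [hA]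
  have a2 : R q (N - (j + 1)) = (1 - q ^ N / q ^ j) * R q (N - j) := by
    have := R_rec hq (N - j)
    rw [show (N : ℤ) - j - 1 = N - (j + 1) by ring] at this
    rw [this, zpow_sub₀ h0]; simp
  have a3 : R q (N - (j - 1)) = A := by rw [hA]; congr 1; ring
  have b1 : R q (N + j) = (1 - q ^ N * q * q ^ j) * B := by
    have := R_rec hq (N + 1 + j)
    rw [show (N : ℤ) + 1 + j - 1 = N + j by ring] at this
    rw [this, zpow_add₀ h0, zpow_add₀ h0]; simp [hB]
  have b2 : R q (N + (j - 1)) = (1 - q ^ N * q ^ j) * R q (N + j) := by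
    have := R_rec hq (N + j)
    rw [show (N : ℤ) + j - 1 = N + (j - 1) by ring] at this
    rw [this, zpow_add₀ h0]; simp
  have b3 : R q (N + (j + 1)) = B := by rw [hB]; congr 1; ring
  push_cast
  rw [← hA, ← hB, a2, a3, b2, b3, a1, b1, e1, t2, t1]
  set X := q ^ j
  field_simp
  ring

noncomputable def P (q w : ℂ) (N : ℕ) : ℂ :=
  ∏ n ∈ Finset.range N, ((1 - q ^ (n + 1) * w) * (1 - q ^ n * w⁻¹))

lemma hasSum_P {q w : ℂ} (h0 : q ≠ 0) (hq : ‖q‖ < 1) (hw : w ≠ 0) (N : ℕ) :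
    HasSum (fun j : ℤ => c q N j * w ^ j) (P q w N) := by
  induction N with
  | zero =>
    have : P q w 0 = c q 0 0 * w ^ (0 : ℤ) := by
      simp [P, c, tri, poch]
      simp [R]
    rw [this]
    apply hasSum_single
    intro j hj
    rcases j with j | j
    · rcases j with _ | j
      · exact absurd rfl hj
      · have : (((0 : ℕ) : ℤ) - Int.ofNat (j + 1)) = Int.negSucc j := by
          simp [Int.negSucc_eq]
        simp only [c]
        rw [this]; simp [R]
    · simp [c, R]
  | succ N ih =>
    have s1 := (Equiv.subRight (1 : ℤ)).hasSum_iff.mpr ih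
    have s2 := (Equiv.addRight (1 : ℤ)).hasSum_iff.mpr ih
    have := ((ih.mul_left (1 + q ^ (2 * N + 1))).sub (s1.mul_left (q ^ (N + 1) * w))).sub
      (s2.mul_left (q ^ N * w⁻¹))
    have e1 : P q w (N + 1) = (1 + q ^ (2 * N + 1)) * P q w N - q ^ (N + 1) * w * P q w N
        - q ^ N * w⁻¹ * P q w N := by
      unfold P
      rw [Finset.prod_range_succ]
      field_simp
      ring
    rw [e1]
    refine this.congr_fun ?_
    · intro j
      rw [c_rec h0 hq]
      simp only [Function.comp, Equiv.subRight_apply, Equiv.coe_addRight]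
      rw [zpow_sub_one₀ hw, zpow_add_one₀ hw]
      field_simp

lemma summable_pow_succ {q : ℂ} (hq : ‖q‖ < 1) (a : ℂ) :
    Summable fun n : ℕ => ‖-(q ^ (n + 1) * a)‖ := by
  simp only [norm_neg, norm_mul, norm_pow]
  apply Summable.mul_right
  exact (summable_nat_add_iff 1).mpr (summable_geometric_of_lt_one (norm_nonneg _) hq)

lemma multipliable_pow {q : ℂ} (hq : ‖q‖ < 1) (a : ℂ) :
    Multipliable fun n : ℕ => (1 - q ^ (n + 1) * a) := by
  have := multipliable_one_add_of_summable (summable_pow_succ hq a)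
  simpa [sub_eq_add_neg] using this

lemma tendsto_poch {q : ℂ} (hq : ‖q‖ < 1) :
    ∃ L : ℂ, L ≠ 0 ∧ Filter.Tendsto (poch q) Filter.atTop (nhds L) := by
  refine ⟨∏' n : ℕ, (1 - q ^ (n + 1)), ?_, ?_⟩
  · have := tprod_one_add_ne_zero_of_summable (f := fun n : ℕ => -(q ^ (n + 1)))
      (fun n => by simpa [sub_eq_add_neg] using one_sub_ne hq n)
      (by simpa using summable_pow_succ hq 1)
    simpa [sub_eq_add_neg] using this
  · have := (multipliable_pow hq 1).hasProd.tendsto_prod_nat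
    simp only [mul_one] at this
    exact this

lemma tendsto_R {q L : ℂ} (hL : L ≠ 0) (h : Filter.Tendsto (poch q) Filter.atTop (nhds L)) :
    Filter.Tendsto (R q) Filter.atTop (nhds L⁻¹) := by
  have h1 := h.inv₀ hL
  have h2 : Filter.Tendsto Int.toNat Filter.atTop Filter.atTop := by
    apply Filter.tendsto_atTop_atTop.mpr
    intro b
    exact ⟨b, fun a ha => by omega⟩
  refine (h1.comp h2).congr' ?_
  filter_upwards [Filter.eventually_ge_atTop 0] with m hm
  obtain ⟨n, rfl⟩ := Int.eq_ofNat_of_zero_le hm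
  simp [poch_eq]

lemma bdd_nat {f : ℕ → ℂ} {L : ℂ} (h : Filter.Tendsto f Filter.atTop (nhds L)) :
    ∃ C : ℝ, 0 ≤ C ∧ ∀ n, ‖f n‖ ≤ C := by
  obtain ⟨C, hC⟩ := (Metric.isBounded_range_of_tendsto f h).exists_norm_le
  have : ∀ n, ‖f n‖ ≤ C := fun n => hC _ ⟨n, rfl⟩
  exact ⟨C, (norm_nonneg _).trans (this 0), this⟩

lemma tendsto_P {q w L : ℂ} (h0 : q ≠ 0) (hq : ‖q‖ < 1) (hw : w ≠ 0) (hL : L ≠ 0)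
    (h : Filter.Tendsto (poch q) Filter.atTop (nhds L))
    (hs : Summable fun j : ℤ => ‖tri q j * w ^ j‖) :
    Filter.Tendsto (P q w) Filter.atTop (nhds (L⁻¹ * ∑' j : ℤ, tri q j * w ^ j)) := by
  obtain ⟨C, hC0, hC⟩ := bdd_nat h
  obtain ⟨D, hD0, hD⟩ := bdd_nat (h.inv₀ hL)
  have hR : ∀ m, ‖R q m‖ ≤ D := by
    intro m
    rcases m with m | m
    · exact hD m
    · simpa [R] using hD0
  have hP : P q w = fun N => ∑' j : ℤ, c q N j * w ^ j := by
    funext N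
    exact (hasSum_P h0 hq hw N).tsum_eq.symm
  rw [hP, ← tsum_mul_left]
  refine tendsto_tsum_of_dominated_convergence (hs.mul_left (C * D * D)) ?_ ?_
  · intro j
    have t1 : Filter.Tendsto (fun N : ℕ => R q (N - j)) Filter.atTop (nhds L⁻¹) :=
      (tendsto_R hL h).comp
        (Filter.tendsto_atTop_add_const_right _ (-j) tendsto_natCast_atTop_atTop)
    have t2 : Filter.Tendsto (fun N : ℕ => R q (N + j)) Filter.atTop (nhds L⁻¹) :=
      (tendsto_R hL h).comp
        (Filter.tendsto_atTop_add_const_right _ j tendsto_natCast_atTop_atTop)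
    have t3 : Filter.Tendsto (fun N : ℕ => poch q (2 * N)) Filter.atTop (nhds L) :=
      h.comp (Filter.tendsto_id.const_mul_atTop' (by norm_num))
    have := (((t3.const_mul (tri q j)).mul t1).mul t2).mul_const (w ^ j)
    have e : L⁻¹ * (tri q j * w ^ j) = tri q j * L * L⁻¹ * L⁻¹ * w ^ j := by
      field_simp
    rw [e]
    exact this
  · refine Filter.Eventually.of_forall fun N j => ?_
    unfold c
    have e : tri q j * poch q (2 * N) * R q (N - j) * R q (N + j) * w ^ j
      = (poch q (2 * N) * R q (N - j) * R q (N + j)) * (tri q j * w ^ j) := by ring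
    rw [e, norm_mul]
    refine mul_le_mul_of_nonneg_right ?_ (norm_nonneg _)
    rw [norm_mul, norm_mul]
    gcongr
    · exact hC _
    · exact hR _
    · exact hR _

lemma triple {q w : ℂ} (h0 : q ≠ 0) (hq : ‖q‖ < 1) (hw : w ≠ 0)
    (hs : Summable fun j : ℤ => ‖tri q j * w ^ j‖) :
    (1 - w⁻¹) * ∏' n : ℕ, ((1 - q ^ (n + 1) * w) * (1 - q ^ (n + 1) * w⁻¹) * (1 - q ^ (n + 1)))
      = ∑' j : ℤ, tri q j * w ^ j := by
  obtain ⟨L, hL, h⟩ := tendsto_poch hq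
  have hm : Multipliable fun n : ℕ =>
      ((1 - q ^ (n + 1) * w) * (1 - q ^ (n + 1) * w⁻¹) * (1 - q ^ (n + 1))) := by
    have := ((multipliable_pow hq w).mul (multipliable_pow hq w⁻¹)).mul (multipliable_pow hq 1)
    simpa using this
  have l1 := hm.hasProd.tendsto_prod_nat.const_mul (1 - w⁻¹)
  have l2 := (tendsto_P h0 hq hw hL h hs).mul h
  have l3 : Filter.Tendsto (fun N : ℕ => 1 - q ^ N * w⁻¹) Filter.atTop (nhds 1) := by
    have := ((tendsto_pow_atTop_nhds_zero_of_norm_lt_one hq).mul_const w⁻¹).const_sub 1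
    simpa using this
  have l4 := l2.mul l3
  have e : L⁻¹ * (∑' j : ℤ, tri q j * w ^ j) * L * 1 = ∑' j : ℤ, tri q j * w ^ j := by
    field_simp
  rw [e] at l4
  refine tendsto_nhds_unique l1 (l4.congr ?_)
  intro N
  induction N with
  | zero => simp [P, poch]
  | succ N ih =>
    rw [Finset.prod_range_succ, ← mul_assoc, ← ih]
    simp only [P, poch, Finset.prod_range_succ]
    ring

/-- Theta series term. -/
noncomputable def t (τ z : ℂ) (n : ℤ) : ℂ :=
  (-1) ^ n * Complex.exp (Real.pi * I * τ * (n + 1 / 2) ^ 2 + 2 * Real.pi * I * z * (n + 1 / 2))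

lemma t_eq (τ z : ℂ) (n : ℤ) : t τ z n =
    Complex.exp (Real.pi * I * τ / 4 + Real.pi * I * z) *
      jacobiTheta₂_term n (z + 1 / 2 + τ / 2) τ := by
  unfold t jacobiTheta₂_term
  have : ((-1 : ℂ)) ^ n = Complex.exp (n * (Real.pi * I)) := by
    rw [Complex.exp_int_mul, Complex.exp_pi_mul_I]
  rw [this, ← Complex.exp_add, ← Complex.exp_add]
  congr 1
  ring

lemma summable_t {τ : ℂ} (hτ : 0 < τ.im) (z : ℂ) : Summable (t τ z) := by
  have := ((summable_jacobiTheta₂_term_iff (z + 1 / 2 + τ / 2) τ).mpr hτ).mul_left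
    (Complex.exp (Real.pi * I * τ / 4 + Real.pi * I * z))
  exact this.congr fun n => (t_eq τ z n).symm

lemma t_tri (τ z : ℂ) (j : ℤ) : t τ z j =
    Complex.exp (Real.pi * I * τ / 4 + Real.pi * I * z) *
      (tri (Complex.exp (2 * Real.pi * I * τ)) j * Complex.exp (2 * Real.pi * I * z) ^ j) := by
  unfold t tri
  rw [← Complex.exp_int_mul, ← Complex.exp_int_mul]
  have h2 : (((j * (j + 1) / 2 : ℤ)) : ℂ) = (j : ℂ) * (j + 1) / 2 := by
    have : (2 : ℤ) ∣ j * (j + 1) := (Int.even_mul_succ_self j).two_dvd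
    rw [Int.cast_div this (by norm_num)]
    push_cast; ring
  rw [h2, mul_assoc ((-1 : ℂ) ^ j), mul_left_comm _ ((-1 : ℂ) ^ j), ← Complex.exp_add,
    ← Complex.exp_add]
  congr 2
  ring

lemma norm_q {τ : ℂ} (hτ : 0 < τ.im) : ‖Complex.exp (2 * Real.pi * I * τ)‖ < 1 := by
  rw [Complex.norm_exp, Real.exp_lt_one_iff]
  have : (2 * Real.pi * I * τ).re = - (2 * Real.pi * τ.im) := by simp
  rw [this]
  have := Real.pi_pos
  have : 0 < 2 * Real.pi * τ.im := by positivity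
  linarith

lemma jTheta_eq {τ : ℂ} (hτ : 0 < τ.im) (z : ℂ) : jTheta τ z = ∑' n : ℤ, t τ z n := by
  have hs := (summable_t hτ z).norm
  simp only [t_tri, norm_mul (Complex.exp (Real.pi * I * τ / 4 + Real.pi * I * z))] at hs
  rw [summable_mul_left_iff (by simp)] at hs
  have := triple (Complex.exp_ne_zero _) (norm_q hτ) (Complex.exp_ne_zero _) hs
  simp only [t_tri]
  rw [tsum_mul_left, ← this]
  unfold jTheta
  rw [Complex.exp_neg (2 * Real.pi * I * z), Complex.exp_neg (Real.pi * I * z), ← mul_assoc,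
    Complex.exp_add]
  congr 1
  have : Complex.exp (2 * Real.pi * I * z) = Complex.exp (Real.pi * I * z) ^ 2 := by
    rw [← Complex.exp_nat_mul]; congr 1; push_cast; ring
  rw [this]
  have := Complex.exp_ne_zero (Real.pi * I * z)
  field_simp

noncomputable def g (τ x : ℂ) (a : ℤ) : ℂ := jacobiTheta₂_term a x (τ / 2)
noncomputable def gE (τ x : ℂ) (a : ℤ) : ℂ := if Even a then g τ x a else 0
noncomputable def gO (τ x : ℂ) (a : ℤ) : ℂ := if Even a then 0 else g τ x a

lemma summable_g {τ : ℂ} (hτ : 0 < τ.im) (x : ℂ) : Summable fun a => ‖g τ x a‖ := by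
  apply Summable.norm
  apply (summable_jacobiTheta₂_term_iff x (τ / 2)).mpr
  simpa using hτ

lemma summable_gE {τ : ℂ} (hτ : 0 < τ.im) (x : ℂ) : Summable fun a => ‖gE τ x a‖ := by
  refine Summable.of_nonneg_of_le (fun _ => norm_nonneg _) (fun a => ?_) (summable_g hτ x)
  unfold gE; split_ifs <;> simp

lemma summable_gO {τ : ℂ} (hτ : 0 < τ.im) (x : ℂ) : Summable fun a => ‖gO τ x a‖ := by
  refine Summable.of_nonneg_of_le (fun _ => norm_nonneg _) (fun a => ?_) (summable_g hτ x)
  unfold gO; split_ifs <;> simp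

lemma hasSum_prod {f h : ℤ → ℂ} (hf : Summable fun a => ‖f a‖) (hh : Summable fun a => ‖h a‖) :
    HasSum (fun p : ℤ × ℤ => f p.1 * h p.2) ((∑' a, f a) * ∑' a, h a) := by
  rw [tsum_mul_tsum_of_summable_norm hf hh]
  exact (summable_mul_of_summable_norm hf hh).hasSum

lemma bracket {τ : ℂ} (hτ : 0 < τ.im) (x y : ℂ) :
    jTheta τ (x + y) * jTheta τ (x - y) =
      (∑' a, gO τ x a) * (∑' a, gE τ y a) - (∑' a, gE τ x a) * (∑' a, gO τ y a) := by
  have H := (hasSum_prod (summable_gO hτ x) (summable_gE hτ y)).sub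
    (hasSum_prod (summable_gE hτ x) (summable_gO hτ y))
  have K := hasSum_prod (summable_t hτ (x + y)).norm (summable_t hτ (x - y)).norm
  rw [jTheta_eq hτ, jTheta_eq hτ]
  let i : ℤ × ℤ → ℤ × ℤ := fun p => (p.1 + p.2 + 1, p.1 - p.2)
  have hi : Function.Injective i := by
    rintro ⟨a, b⟩ ⟨a', b'⟩ h
    simp only [i, Prod.mk.injEq] at h
    ext <;> simp <;> omega
  rw [← hi.hasSum_iff] at H
  · refine K.unique (H.congr_fun ?_)
    rintro ⟨m, n⟩
    simp only [Function.comp, i]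
    have hg : g τ x (m + n + 1) * g τ y (m - n) =
        Complex.exp (Real.pi * I * τ * (m + 1 / 2) ^ 2 + 2 * Real.pi * I * (x + y) * (m + 1 / 2)) *
        Complex.exp (Real.pi * I * τ * (n + 1 / 2) ^ 2 + 2 * Real.pi * I * (x - y) * (n + 1 / 2)) := by
      unfold g jacobiTheta₂_term
      rw [← Complex.exp_add, ← Complex.exp_add]
      congr 1
      push_cast
      ring
    unfold t
    rw [mul_mul_mul_comm, ← hg, ← zpow_add₀ (by norm_num)]
    rcases Int.even_or_odd (m + n) with h | h
    · have h1 : ¬ Even (m + n + 1) := by grind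
      have h2 : Even (m - n) := by grind
      simp [gE, gO, h1, h2, h.neg_one_zpow]
    · have h1 : Even (m + n + 1) := by grind
      have h2 : ¬ Even (m - n) := by grind
      simp [gE, gO, h1, h2, h.neg_one_zpow]
  · rintro ⟨a, b⟩ hab
    have : ¬ Odd (a + b) := by
      rintro ⟨k, hk⟩
      apply hab
      refine ⟨(k, a - 1 - k), ?_⟩
      simp only [i, Prod.mk.injEq]
      omega
    rcases Int.even_or_odd a with h | h <;> rcases Int.even_or_odd b with h' | h'
    · simp [gE, gO, h, h']
    · grind
    · grind
    · have h1 : ¬ Even a := by grind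
      have h2 : ¬ Even b := by grind
      simp [gE, gO, h1, h2]

lemma weier {τ : ℂ} (hτ : 0 < τ.im) (p r s u : ℂ) :
    (jTheta τ (s + p) * jTheta τ (s - p)) * (jTheta τ (u + r) * jTheta τ (u - r)) =
    (jTheta τ (p + r) * jTheta τ (p - r)) * (jTheta τ (s + u) * jTheta τ (s - u)) -
    (jTheta τ (p + u) * jTheta τ (p - u)) * (jTheta τ (s + r) * jTheta τ (s - r)) := by
  simp only [bracket hτ]
  ring

end TB

/-- Weight-2 theta-block decomposition: `φ_{2,a} = φ^{(1)}_{2,a} − φ^{(2)}_{2,a}`. -/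
theorem phi2_decomposition (a₁ a₂ a₃ a₄ : ℤ) (τ z : ℂ) (hτ : 0 < τ.im) :
    phi2 a₁ a₂ a₃ a₄ τ z =
      dedekindEta τ ^ (-6 : ℤ) *
        (jTheta τ ((a₁ : ℂ) * z) * jTheta τ ((a₂ : ℂ) * z) *
          jTheta τ (((a₂ + a₃ : ℤ) : ℂ) * z) *
          jTheta τ (((a₂ + 2 * a₃ + 2 * a₄ : ℤ) : ℂ) * z) *
          jTheta τ (((a₁ + a₂ : ℤ) : ℂ) * z) *
          jTheta τ (((a₂ + a₃ + 2 * a₄ : ℤ) : ℂ) * z) *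
          jTheta τ ((a₃ : ℂ) * z) *
          jTheta τ (((a₁ - a₃ : ℤ) : ℂ) * z) *
          jTheta τ (((a₃ + 2 * a₄ : ℤ) : ℂ) * z) *
          jTheta τ (((a₁ + a₂ + a₃ + 2 * a₄ : ℤ) : ℂ) * z)) -
      dedekindEta τ ^ (-6 : ℤ) *
        (jTheta τ (((a₁ - a₃ - a₄ : ℤ) : ℂ) * z) * jTheta τ ((a₂ : ℂ) * z) *
          jTheta τ (((a₂ + a₃ : ℤ) : ℂ) * z) *
          jTheta τ (((a₂ + 2 * a₃ + 2 * a₄ : ℤ) : ℂ) * z) *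
          jTheta τ (((a₁ + a₂ + a₃ + a₄ : ℤ) : ℂ) * z) *
          jTheta τ (((a₂ + a₃ + 2 * a₄ : ℤ) : ℂ) * z) *
          jTheta τ ((a₃ : ℂ) * z) *
          jTheta τ (((a₁ + a₄ : ℤ) : ℂ) * z) *
          jTheta τ (((a₃ + 2 * a₄ : ℤ) : ℂ) * z) *
          jTheta τ (((a₁ + a₂ + a₄ : ℤ) : ℂ) * z)) := by
  have key := TB.weier hτ (((a₁ : ℂ) + a₂ / 2) * z) ((a₂ : ℂ) / 2 * z)
    (((a₁ : ℂ) + a₂ / 2 + a₄) * z) (((a₂ : ℂ) / 2 + a₃ + a₄) * z)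
  have e1 : ((a₁ : ℂ) + a₂ / 2 + a₄) * z + ((a₁ : ℂ) + a₂ / 2) * z
    = ((2 * a₁ + a₂ + a₄ : ℤ) : ℂ) * z := by push_cast; ring
  have e2 : ((a₁ : ℂ) + a₂ / 2 + a₄) * z - ((a₁ : ℂ) + a₂ / 2) * z = (a₄ : ℂ) * z := by ring
  have e3 : ((a₂ : ℂ) / 2 + a₃ + a₄) * z + (a₂ : ℂ) / 2 * z
    = ((a₂ + a₃ + a₄ : ℤ) : ℂ) * z := by push_cast; ring
  have e4 : ((a₂ : ℂ) / 2 + a₃ + a₄) * z - (a₂ : ℂ) / 2 * z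
    = ((a₃ + a₄ : ℤ) : ℂ) * z := by push_cast; ring
  have e5 : ((a₁ : ℂ) + a₂ / 2) * z + (a₂ : ℂ) / 2 * z
    = ((a₁ + a₂ : ℤ) : ℂ) * z := by push_cast; ring
  have e6 : ((a₁ : ℂ) + a₂ / 2) * z - (a₂ : ℂ) / 2 * z = (a₁ : ℂ) * z := by ring
  have e7 : ((a₁ : ℂ) + a₂ / 2 + a₄) * z + ((a₂ : ℂ) / 2 + a₃ + a₄) * z
    = ((a₁ + a₂ + a₃ + 2 * a₄ : ℤ) : ℂ) * z := by push_cast; ring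
  have e8 : ((a₁ : ℂ) + a₂ / 2 + a₄) * z - ((a₂ : ℂ) / 2 + a₃ + a₄) * z
    = ((a₁ - a₃ : ℤ) : ℂ) * z := by push_cast; ring
  have e9 : ((a₁ : ℂ) + a₂ / 2) * z + ((a₂ : ℂ) / 2 + a₃ + a₄) * z
    = ((a₁ + a₂ + a₃ + a₄ : ℤ) : ℂ) * z := by push_cast; ring
  have e10 : ((a₁ : ℂ) + a₂ / 2) * z - ((a₂ : ℂ) / 2 + a₃ + a₄) * z
    = ((a₁ - a₃ - a₄ : ℤ) : ℂ) * z := by push_cast; ring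
  have e11 : ((a₁ : ℂ) + a₂ / 2 + a₄) * z + (a₂ : ℂ) / 2 * z
    = ((a₁ + a₂ + a₄ : ℤ) : ℂ) * z := by push_cast; ring
  have e12 : ((a₁ : ℂ) + a₂ / 2 + a₄) * z - (a₂ : ℂ) / 2 * z
    = ((a₁ + a₄ : ℤ) : ℂ) * z := by push_cast; ring
  rw [e1, e2, e3, e4, e5, e6, e7, e8, e9, e10, e11, e12] at key
  unfold phi2
  linear_combination dedekindEta τ ^ (-6 : ℤ) * jTheta τ ((a₂ : ℂ) * z) *
    jTheta τ (((a₂ + a₃ : ℤ) : ℂ) * z) * jTheta τ (((a₂ + 2 * a₃ + 2 * a₄ : ℤ) : ℂ) * z) *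
    jTheta τ (((a₂ + a₃ + 2 * a₄ : ℤ) : ℂ) * z) * jTheta τ ((a₃ : ℂ) * z) *
    jTheta τ (((a₃ + 2 * a₄ : ℤ) : ℂ) * z) * key
end

section
/- (Weight-3 theta-block decomposition) For every b = (b₁,…,b₆) ∈ ℤ⁶, every τ ∈ ℍ and every z ∈ ℂ, writing ϑ_c for ϑ(τ,cz), one has φ_{3,b}(τ,z) = φ^{(1)}_{3,b}(τ,z) − φ^{(2)}_{3,b}(τ,z), where φ^{(1)}_{3,b} = η^{−3}·ϑ_{b₅}ϑ_{b₆}ϑ_{b₅+b₆}ϑ_{b₃+2b₄}ϑ_{b₃}ϑ_{b₂−b₄}ϑ_{b₂+b₃+b₄}ϑ_{b₂−b₁}ϑ_{b₂+b₃−b₁} and φ^{(2)}_{3,b} = η^{−3}·ϑ_{b₅}ϑ_{b₆}ϑ_{b₅+b₆}ϑ_{b₃+2b₄}ϑ_{b₃}ϑ_{b₂−b₁−b₄}ϑ_{b₂+b₃+b₄−b₁}ϑ_{b₂+b₃}ϑ_{b₂}. -/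
open Complex

/-- The weight-3 theta block `φ_{3,b}` attached to `b = (b₁,…,b₆) ∈ ℤ⁶`. -/
noncomputable def phi3 (b₁ b₂ b₃ b₄ b₅ b₆ : ℤ) (τ z : ℂ) : ℂ :=
  dedekindEta τ ^ (-3 : ℤ) *
    (jTheta τ ((b₁ : ℂ) * z) * jTheta τ (((2 * b₂ + b₃ - b₁ : ℤ) : ℂ) * z) *
      jTheta τ ((b₃ : ℂ) * z) * jTheta τ (((b₃ + b₄ : ℤ) : ℂ) * z) *
      jTheta τ (((b₃ + 2 * b₄ : ℤ) : ℂ) * z) * jTheta τ ((b₄ : ℂ) * z) *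
      jTheta τ ((b₅ : ℂ) * z) * jTheta τ ((b₆ : ℂ) * z) *
      jTheta τ (((b₅ + b₆ : ℤ) : ℂ) * z))

namespace ThetaAux

open Filter Topology

/-- Finite `q`-Pochhammer symbol `(q;q)_m`. -/
noncomputable def qP (q : ℂ) (m : ℕ) : ℂ := ∏ k ∈ Finset.range m, (1 - q ^ (k + 1))

/-- `1/(q;q)_m`, extended by zero to negative `m`. -/
noncomputable def rI (q : ℂ) (m : ℤ) : ℂ := if m < 0 then 0 else (qP q m.toNat)⁻¹

lemma rI_nat (q : ℂ) (m : ℕ) : rI q m = (qP q m)⁻¹ := by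
  simp [rI]

lemma rI_sub_one {q : ℂ} (hq : ∀ k : ℕ, 1 - q ^ (k + 1) ≠ 0) (m : ℤ) :
    rI q (m - 1) = (1 - q ^ m) * rI q m := by
  rcases lt_trichotomy m 0 with h | h | h
  · rw [rI, rI, if_pos (by omega), if_pos h, mul_zero]
  · subst h; simp [rI]
  · obtain ⟨k, rfl⟩ : ∃ k : ℕ, m = (k : ℤ) + 1 := ⟨(m - 1).toNat, by omega⟩
    have e : rI q ((k : ℤ) + 1) = (qP q (k + 1))⁻¹ := by exact_mod_cast rI_nat q (k + 1)
    have e2 : q ^ ((k : ℤ) + 1) = q ^ (k + 1) := by exact_mod_cast zpow_natCast q (k + 1)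
    rw [add_sub_cancel_right, rI_nat, e, e2, qP, qP, Finset.prod_range_succ, mul_inv,
      mul_comm (_)⁻¹ (_)⁻¹, ← mul_assoc, mul_inv_cancel₀ (hq k), one_mul]

/-- The terms of the theta series. -/
noncomputable def E (τ z : ℂ) (j : ℤ) : ℂ := jacobiTheta₂_term j (z + 1 / 2 - τ / 2) τ

lemma E_succ (τ z : ℂ) (j : ℤ) :
    E τ z (j + 1) = - (E τ z j * cexp (2 * Real.pi * I * z) * cexp (2 * Real.pi * I * τ) ^ j) := by
  unfold E jacobiTheta₂_term
  rw [← Complex.exp_int_mul, ← Complex.exp_add, ← Complex.exp_add, ← neg_one_mul,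
    ← Complex.exp_pi_mul_I, ← Complex.exp_add]
  congr 1
  push_cast
  ring

/-- Finite form of the triple product. -/
lemma finite_triple (τ z : ℂ) (hq : ∀ k : ℕ, 1 - cexp (2 * Real.pi * I * τ) ^ (k + 1) ≠ 0)
    (n : ℕ) :
    HasSum (fun j : ℤ => qP (cexp (2 * Real.pi * I * τ)) (2 * n) *
        (rI (cexp (2 * Real.pi * I * τ)) (n + j) * rI (cexp (2 * Real.pi * I * τ)) (n - j)) *
        E τ z j)
      (∏ k ∈ Finset.range n, ((1 - cexp (2 * Real.pi * I * τ) ^ k * cexp (2 * Real.pi * I * z)) *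
        (1 - cexp (2 * Real.pi * I * τ) ^ (k + 1) * (cexp (2 * Real.pi * I * z))⁻¹))) := by
  have hE := E_succ τ z
  have hq0 : cexp (2 * Real.pi * I * τ) ≠ 0 := Complex.exp_ne_zero _
  have hX0 : cexp (2 * Real.pi * I * z) ≠ 0 := Complex.exp_ne_zero _
  generalize cexp (2 * Real.pi * I * τ) = q at *
  generalize cexp (2 * Real.pi * I * z) = X at *
  induction n with
  | zero =>
    simp only [Finset.range_zero, Finset.prod_empty]
    have h := hasSum_single (f := fun j : ℤ => qP q (2 * 0) *
        (rI q ((0 : ℕ) + j) * rI q ((0 : ℕ) - j)) * E τ z j) 0 ?_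
    · have e : E τ z 0 = 1 := by simp [E, jacobiTheta₂_term]
      simpa [e, qP, rI] using h
    · intro j hj
      have : rI q ((0 : ℕ) + j) * rI q ((0 : ℕ) - j) = 0 := by
        rcases lt_or_gt_of_ne hj with h | h
        · rw [rI, if_pos (by simpa using h), zero_mul]
        · rw [mul_comm, rI, if_pos (by simpa using h), zero_mul]
      simp only [this, mul_zero, zero_mul]
  | succ n ih =>
    rw [Finset.prod_range_succ]
    have h1 := ih.mul_right (1 + q ^ (2 * n + 1))
    have h2 := ((Equiv.subRight (1 : ℤ)).hasSum_iff.mpr ih).mul_right (q ^ n * X)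
    have h3 := ((Equiv.addRight (1 : ℤ)).hasSum_iff.mpr ih).mul_right (q ^ (n + 1) * X⁻¹)
    have h4 := (h1.sub h2).sub h3
    have hval : ∀ p : ℂ, p * ((1 - q ^ n * X) * (1 - q ^ (n + 1) * X⁻¹)) =
        p * (1 + q ^ (2 * n + 1)) - p * (q ^ n * X) - p * (q ^ (n + 1) * X⁻¹) := by
      intro p
      field_simp
      ring
    rw [hval]
    refine h4.congr_fun ?_
    · intro j
      simp only [Function.comp, Equiv.subRight_apply, Equiv.coe_addRight]
      have r1 : rI q (n + j) = (1 - q ^ (n + 1 + j)) * rI q (n + 1 + j) := by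
        rw [← rI_sub_one hq]; congr 1; ring
      have r2 : rI q (n - j) = (1 - q ^ (n + 1 - j)) * rI q (n + 1 - j) := by
        rw [← rI_sub_one hq]; congr 1; ring
      have r3 : rI q (n + (j - 1)) = (1 - q ^ (n + j)) * rI q (n + j) := by
        rw [← rI_sub_one hq]; congr 1; ring
      have r4 : rI q (n - (j + 1)) = (1 - q ^ (n - j)) * rI q (n - j) := by
        rw [← rI_sub_one hq]; congr 1; ring
      have r5 : (n : ℤ) - (j - 1) = n + 1 - j := by ring
      have r6 : (n : ℤ) + (j + 1) = n + 1 + j := by ring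
      have e2 := hE (j - 1)
      rw [sub_add_cancel] at e2
      have e3 : E τ z (j - 1) * X = - (E τ z j * (q ^ (j - 1))⁻¹) := by
        rw [e2]
        field_simp
      have q1 : qP q (2 * (n + 1)) = qP q (2 * n) * (1 - q ^ (2 * n + 1)) * (1 - q ^ (2 * n + 2)) := by
        rw [qP, qP, mul_add, mul_one, Finset.prod_range_succ, Finset.prod_range_succ]
      have e4 : ∀ a : ℂ, a * E τ z (j - 1) * (q ^ n * X) = - (a * E τ z j * q ^ n * (q ^ (j - 1))⁻¹) := by
        intro a
        calc _ = a * q ^ n * (E τ z (j - 1) * X) := by ring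
          _ = _ := by rw [e3]; ring
      rw [e4, hE j, r3, r4, r5, r6, r1, r2, q1]
      push_cast
      generalize rI q (n + 1 + j) = R
      generalize rI q (n + 1 - j) = S
      generalize E τ z j = e
      generalize qP q (2 * n) = P
      simp only [zpow_add₀ hq0, zpow_sub₀ hq0, zpow_natCast, zpow_one]
      have hz : q ^ j ≠ 0 := zpow_ne_zero _ hq0
      generalize q ^ j = Z at *
      field_simp
      ring

lemma summable_aux {q : ℂ} (hq : ‖q‖ < 1) (X : ℂ) : Summable fun n : ℕ => ‖-(q ^ (n + 1) * X)‖ := by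
  simp only [norm_neg, norm_mul, norm_pow]
  exact ((summable_nat_add_iff 1).mpr (summable_geometric_of_lt_one (norm_nonneg _) hq)).mul_right _

lemma mult_aux {q : ℂ} (hq : ‖q‖ < 1) (X : ℂ) : Multipliable fun n : ℕ => (1 - q ^ (n + 1) * X) := by
  simpa [sub_eq_add_neg] using multipliable_one_add_of_summable (summable_aux hq X)

lemma norm_q_lt {τ : ℂ} (hτ : 0 < τ.im) : ‖cexp (2 * Real.pi * I * τ)‖ < 1 := by
  rw [Complex.norm_exp, Real.exp_lt_one_iff]
  have : (2 * Real.pi * I * τ).re = -(2 * Real.pi * τ.im) := by simp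
  rw [this]
  have := Real.pi_pos
  simp only [Left.neg_neg_iff]
  positivity

lemma one_sub_ne {q : ℂ} (hq : ‖q‖ < 1) (k : ℕ) : 1 - q ^ (k + 1) ≠ 0 := by
  intro h
  have h1 : ‖q ^ (k + 1)‖ = 1 := by rw [← sub_eq_zero.mp h, norm_one]
  rw [norm_pow] at h1
  exact absurd h1 (pow_lt_one₀ (norm_nonneg _) hq (by omega)).ne

lemma qP_tendsto {q : ℂ} (hq : ‖q‖ < 1) : ∃ L : ℂ, L ≠ 0 ∧ Tendsto (qP q) atTop (𝓝 L) := by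
  refine ⟨∏' n : ℕ, (1 - q ^ (n + 1)), ?_, ?_⟩
  · have h := tprod_one_add_ne_zero_of_summable (f := fun n : ℕ => -(q ^ (n + 1) * 1))
      (fun k => by simpa [sub_eq_add_neg] using one_sub_ne hq k) (summable_aux hq 1)
    simpa [sub_eq_add_neg] using h
  · have h := (mult_aux hq 1).tendsto_prod_tprod_nat
    simp only [mul_one] at h
    exact h

lemma rI_tendsto {q L : ℂ} (hL : L ≠ 0) (h : Tendsto (qP q) atTop (𝓝 L)) :
    Tendsto (rI q) atTop (𝓝 L⁻¹) := by
  have h1 : Tendsto (fun m : ℤ => (qP q m.toNat)⁻¹) atTop (𝓝 L⁻¹) :=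
    (h.comp (tendsto_atTop.mpr fun n => (eventually_ge_atTop (n : ℤ)).mono fun m hm => by omega)).inv₀ hL
  refine h1.congr' ?_
  filter_upwards [eventually_ge_atTop 0] with m hm
  rw [rI, if_neg (by omega)]

lemma bdd_of_tendsto {f : ℕ → ℂ} {L : ℂ} (h : Tendsto f atTop (𝓝 L)) : ∃ C, ∀ n, ‖f n‖ ≤ C := by
  obtain ⟨C, hC⟩ := (Metric.isBounded_range_of_tendsto f h).exists_norm_le
  exact ⟨C, fun n => hC _ ⟨n, rfl⟩⟩

lemma rI_bdd {q L : ℂ} (hL : L ≠ 0) (h : Tendsto (qP q) atTop (𝓝 L)) :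
    ∃ C, ∀ m, ‖rI q m‖ ≤ C := by
  obtain ⟨C, hC⟩ := bdd_of_tendsto (h.inv₀ hL)
  refine ⟨C, fun m => ?_⟩
  rw [rI]
  split_ifs
  · rw [norm_zero]; exact (norm_nonneg _).trans (hC 0)
  · exact hC _

/-- Triple product, up to a constant depending only on `τ`. -/
lemma jTheta_eq {τ : ℂ} (hτ : 0 < τ.im) : ∃ K : ℂ, ∀ z : ℂ,
    jTheta τ z = K * (cexp (-(Real.pi * I * z)) * jacobiTheta₂ (z + 1 / 2 - τ / 2) τ) := by
  have hq := norm_q_lt hτ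
  obtain ⟨L, hL, hP⟩ := qP_tendsto hq
  obtain ⟨C, hC⟩ := rI_bdd hL hP
  obtain ⟨C', hC'⟩ := bdd_of_tendsto hP
  have hr := rI_tendsto hL hP
  refine ⟨-cexp (Real.pi * I * τ / 4), fun z => ?_⟩
  have hfin := finite_triple τ z (one_sub_ne hq)
  have hS : Summable (E τ z) := (summable_jacobiTheta₂_term_iff _ _).mpr hτ
  have hts : ∑' j, E τ z j = jacobiTheta₂ (z + 1 / 2 - τ / 2) τ := rfl
  unfold jTheta
  have hw : cexp (2 * Real.pi * I * z) = cexp (Real.pi * I * z) * cexp (Real.pi * I * z) := by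
    rw [← Complex.exp_add]; congr 1; ring
  rw [Complex.exp_neg (2 * Real.pi * I * z), Complex.exp_neg (Real.pi * I * z)]
  have hw0 : cexp (Real.pi * I * z) ≠ 0 := Complex.exp_ne_zero _
  rw [← hts]
  generalize cexp (2 * Real.pi * I * τ) = q at *
  have key : Tendsto (fun n : ℕ => ∑' j : ℤ, qP q (2 * n) * (rI q (n + j) * rI q (n - j)) * E τ z j)
      atTop (𝓝 (∑' j : ℤ, L * (L⁻¹ * L⁻¹) * E τ z j)) := by
    refine tendsto_tsum_of_dominated_convergence (bound := fun j => C' * (C * C) * ‖E τ z j‖)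
      (hS.norm.mul_left _) ?_ ?_
    · intro j
      refine Tendsto.mul_const _ (Tendsto.mul ?_ (Tendsto.mul ?_ ?_))
      · exact hP.comp (tendsto_id.const_mul_atTop' (by norm_num))
      · exact hr.comp (tendsto_atTop_add_const_right _ j tendsto_natCast_atTop_atTop)
      · exact hr.comp (tendsto_atTop_add_const_right _ (-j) tendsto_natCast_atTop_atTop)
    · refine Eventually.of_forall fun n j => ?_
      rw [norm_mul, norm_mul, norm_mul]
      have hC0 : 0 ≤ C := (norm_nonneg _).trans (hC 0)
      have hC0' : 0 ≤ C' := (norm_nonneg _).trans (hC' 0)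
      gcongr <;> apply_assumption
  simp only [fun n => (hfin n).tsum_eq] at key
  rw [tsum_mul_left] at key
  generalize cexp (2 * Real.pi * I * z) = X at *
  have hT : Tendsto (fun n : ℕ => (1 - X) * ∏ k ∈ Finset.range n, ((1 - q ^ (k + 1) * X) *
      (1 - q ^ (k + 1) * X⁻¹) * (1 - q ^ (k + 1)))) atTop
      (𝓝 ((1 - X) * ∏' k : ℕ, ((1 - q ^ (k + 1) * X) *
      (1 - q ^ (k + 1) * X⁻¹) * (1 - q ^ (k + 1))))) := by
    have h1 : Multipliable fun k : ℕ => 1 - q ^ (k + 1) := by simpa using mult_aux hq 1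
    exact ((((mult_aux hq X).mul (mult_aux hq X⁻¹)).mul h1).tendsto_prod_tprod_nat).const_mul _
  have hT2 : Tendsto (fun n : ℕ => (1 - X) * ∏ k ∈ Finset.range n, ((1 - q ^ (k + 1) * X) *
      (1 - q ^ (k + 1) * X⁻¹) * (1 - q ^ (k + 1)))) atTop
      (𝓝 ((L * (L⁻¹ * L⁻¹) * ∑' j, E τ z j) * (1 - 0 * X) * L)) := by
    refine ((key.mul ((tendsto_const_nhds (x := (1 : ℂ))).sub
      ((tendsto_pow_atTop_nhds_zero_of_norm_lt_one hq).mul_const X))).mul hP).congr fun n => ?_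
    rw [Finset.prod_mul_distrib, Finset.prod_mul_distrib, Finset.prod_mul_distrib]
    have h0 : (∏ k ∈ Finset.range n, (1 - q ^ k * X)) * (1 - q ^ n * X) =
        (1 - X) * ∏ k ∈ Finset.range n, (1 - q ^ (k + 1) * X) := by
      rw [← Finset.prod_range_succ (fun k => 1 - q ^ k * X), Finset.prod_range_succ']
      simp [mul_comm]
    rw [qP]
    linear_combination (∏ k ∈ Finset.range n, (1 - q ^ (k + 1) * X⁻¹)) *
      (∏ k ∈ Finset.range n, (1 - q ^ (k + 1))) * h0
  have hfinal := tendsto_nhds_unique hT hT2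
  have h3 : (L * (L⁻¹ * L⁻¹) * ∑' j, E τ z j) * (1 - 0 * X) * L = ∑' j, E τ z j := by
    field_simp
    ring
  rw [h3] at hfinal
  rw [← hfinal, hw]
  field_simp
  ring

/-- Splitting `ℤ × ℤ` by parity of the sum of the coordinates. -/
def parityEquiv : (ℤ × ℤ) ⊕ (ℤ × ℤ) ≃ ℤ × ℤ where
  toFun := Sum.elim (fun p => (p.1 + p.2, p.1 - p.2)) (fun p => (p.1 + p.2 + 1, p.1 - p.2))
  invFun p := if (p.1 + p.2) % 2 = 0 then Sum.inl ((p.1 + p.2) / 2, (p.1 - p.2) / 2)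
    else Sum.inr ((p.1 + p.2) / 2, (p.1 - p.2) / 2)
  left_inv := by
    rintro (⟨a, b⟩ | ⟨a, b⟩)
    · have h : (a + b + (a - b)) % 2 = 0 := by omega
      simp only [Sum.elim_inl, h, if_true, Sum.inl.injEq, Prod.mk.injEq]
      omega
    · have h : ¬ (a + b + 1 + (a - b)) % 2 = 0 := by omega
      simp only [Sum.elim_inr, h, if_false, Sum.inr.injEq, Prod.mk.injEq]
      omega
  right_inv := by
    rintro ⟨a, b⟩
    by_cases h : (a + b) % 2 = 0
    · simp only [h, if_true, Sum.elim_inl, Prod.mk.injEq]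
      omega
    · simp only [h, if_false, Sum.elim_inr, Prod.mk.injEq]
      omega

lemma theta_mul {τ τ' : ℂ} (hτ : 0 < τ.im) (hτ' : 0 < τ'.im) (u v : ℂ) :
    HasSum (fun p : ℤ × ℤ => jacobiTheta₂_term p.1 u τ * jacobiTheta₂_term p.2 v τ')
      (jacobiTheta₂ u τ * jacobiTheta₂ v τ') := by
  have h1 := hasSum_jacobiTheta₂_term u hτ
  have h2 := hasSum_jacobiTheta₂_term v hτ'
  have h3 := summable_mul_of_summable_norm h1.summable.norm h2.summable.norm
  have h4 := tsum_mul_tsum_of_summable_norm h1.summable.norm h2.summable.norm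
  have h5 := h3.hasSum
  rw [← h4] at h5
  exact h5

lemma theta_add_sub {τ : ℂ} (hτ : 0 < τ.im) (x y : ℂ) :
    jacobiTheta₂ (x + y) τ * jacobiTheta₂ (x - y) τ =
      jacobiTheta₂ (2 * x) (2 * τ) * jacobiTheta₂ (2 * y) (2 * τ) +
      cexp (2 * Real.pi * I * x + Real.pi * I * τ) *
        (jacobiTheta₂ (2 * x + τ) (2 * τ) * jacobiTheta₂ (2 * y + τ) (2 * τ)) *
          cexp (2 * Real.pi * I * y) := by
  have h2 : 0 < (2 * τ).im := by simpa using hτ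
  have h := parityEquiv.hasSum_iff.mpr (theta_mul hτ hτ (x + y) (x - y))
  refine h.unique (HasSum.sum ?_ ?_)
  · refine (theta_mul h2 h2 (2 * x) (2 * y)).congr_fun ?_
    rintro ⟨a, b⟩
    simp only [parityEquiv, Function.comp, Equiv.coe_fn_mk, Sum.elim_inl, jacobiTheta₂_term,
      ← Complex.exp_add]
    congr 1
    push_cast
    ring
  · refine (((theta_mul h2 h2 (2 * x + τ) (2 * y + τ)).mul_left _).mul_right _).congr_fun ?_
    rintro ⟨a, b⟩
    simp only [parityEquiv, Function.comp, Equiv.coe_fn_mk, Sum.elim_inr, jacobiTheta₂_term,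
      ← Complex.exp_add]
    congr 1
    push_cast
    ring

lemma jTheta_add_sub {τ : ℂ} (hτ : 0 < τ.im) : ∃ (K : ℂ) (α β : ℂ → ℂ), ∀ x y : ℂ,
    jTheta τ (x + y) * jTheta τ (x - y) = K * (α x * β y - β x * α y) := by
  obtain ⟨K, hK⟩ := jTheta_eq hτ
  refine ⟨K ^ 2, fun x => cexp (-(2 * Real.pi * I * x)) * jacobiTheta₂ (2 * x - τ) (2 * τ),
    fun x => jacobiTheta₂ (2 * x) (2 * τ), fun x y => ?_⟩
  have h := theta_add_sub hτ (x + 1 / 2 - τ / 2) y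
  have a1 : x + 1 / 2 - τ / 2 + y = x + y + 1 / 2 - τ / 2 := by ring
  have a2 : x + 1 / 2 - τ / 2 - y = x - y + 1 / 2 - τ / 2 := by ring
  have a3 : 2 * (x + 1 / 2 - τ / 2) = 2 * x - τ + 1 := by ring
  have a4 : 2 * x - τ + 1 + τ = 2 * x + 1 := by ring
  have a5 : 2 * y + τ = 2 * y - τ + 2 * τ := by ring
  rw [a1, a2, a3, a4, a5, jacobiTheta₂_add_left, jacobiTheta₂_add_left,
    jacobiTheta₂_add_left'] at h
  have b1 : cexp (-(Real.pi * I * (x + y))) * cexp (-(Real.pi * I * (x - y))) =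
      cexp (-(2 * Real.pi * I * x)) := by
    rw [← Complex.exp_add]; congr 1; ring
  have b2 : cexp (-(2 * Real.pi * I * x)) *
      (cexp (2 * Real.pi * I * (x + 1 / 2 - τ / 2) + Real.pi * I * τ) *
        cexp (-Real.pi * I * (2 * τ + 2 * (2 * y - τ))) * cexp (2 * Real.pi * I * y)) =
      - cexp (-(2 * Real.pi * I * y)) := by
    rw [← neg_one_mul (cexp (-(2 * Real.pi * I * y))), ← Complex.exp_pi_mul_I, ← Complex.exp_add,
      ← Complex.exp_add, ← Complex.exp_add, ← Complex.exp_add]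
    congr 1; ring
  rw [hK, hK]
  linear_combination K ^ 2 * jacobiTheta₂ (x + y + 1 / 2 - τ / 2) τ *
    jacobiTheta₂ (x - y + 1 / 2 - τ / 2) τ * b1 + K ^ 2 * cexp (-(2 * Real.pi * I * x)) * h +
    K ^ 2 * jacobiTheta₂ (2 * x) (2 * τ) * jacobiTheta₂ (2 * y - τ) (2 * τ) * b2

lemma weierstrass {τ : ℂ} (hτ : 0 < τ.im) (A B C D : ℂ) :
    jTheta τ (A + B) * jTheta τ (A - B) * (jTheta τ (C + D) * jTheta τ (C - D)) =
      jTheta τ (A + C) * jTheta τ (A - C) * (jTheta τ (B + D) * jTheta τ (B - D)) -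
      jTheta τ (B + C) * jTheta τ (B - C) * (jTheta τ (A + D) * jTheta τ (A - D)) := by
  obtain ⟨K, α, β, h⟩ := jTheta_add_sub hτ
  simp only [h]
  ring

end ThetaAux

/-- Weight-3 theta-block decomposition: `φ_{3,b} = φ^{(1)}_{3,b} − φ^{(2)}_{3,b}`. -/
theorem phi3_decomposition (b₁ b₂ b₃ b₄ b₅ b₆ : ℤ) (τ z : ℂ) (hτ : 0 < τ.im) :
    phi3 b₁ b₂ b₃ b₄ b₅ b₆ τ z =
      dedekindEta τ ^ (-3 : ℤ) *
        (jTheta τ ((b₅ : ℂ) * z) * jTheta τ ((b₆ : ℂ) * z) *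
          jTheta τ (((b₅ + b₆ : ℤ) : ℂ) * z) *
          jTheta τ (((b₃ + 2 * b₄ : ℤ) : ℂ) * z) *
          jTheta τ ((b₃ : ℂ) * z) *
          jTheta τ (((b₂ - b₄ : ℤ) : ℂ) * z) *
          jTheta τ (((b₂ + b₃ + b₄ : ℤ) : ℂ) * z) *
          jTheta τ (((b₂ - b₁ : ℤ) : ℂ) * z) *
          jTheta τ (((b₂ + b₃ - b₁ : ℤ) : ℂ) * z)) -
      dedekindEta τ ^ (-3 : ℤ) *
        (jTheta τ ((b₅ : ℂ) * z) * jTheta τ ((b₆ : ℂ) * z) *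
          jTheta τ (((b₅ + b₆ : ℤ) : ℂ) * z) *
          jTheta τ (((b₃ + 2 * b₄ : ℤ) : ℂ) * z) *
          jTheta τ ((b₃ : ℂ) * z) *
          jTheta τ (((b₂ - b₁ - b₄ : ℤ) : ℂ) * z) *
          jTheta τ (((b₂ + b₃ + b₄ - b₁ : ℤ) : ℂ) * z) *
          jTheta τ (((b₂ + b₃ : ℤ) : ℂ) * z) *
          jTheta τ ((b₂ : ℂ) * z)) := by
  have h := ThetaAux.weierstrass hτ ((b₂ + b₃ / 2) * z) ((b₂ + b₃ / 2 - b₁) * z)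
    ((b₃ / 2 + b₄) * z) ((b₃ / 2) * z)
  have e : ∀ {u v : ℂ}, u = v → jTheta τ u = jTheta τ v := fun h => by rw [h]
  unfold phi3
  push_cast
  rw [e (show ((b₂ : ℂ) + b₃ / 2) * z + (b₂ + b₃ / 2 - b₁) * z = (2 * b₂ + b₃ - b₁) * z by ring),
    e (show ((b₂ : ℂ) + b₃ / 2) * z - (b₂ + b₃ / 2 - b₁) * z = b₁ * z by ring),
    e (show ((b₃ : ℂ) / 2 + b₄) * z + b₃ / 2 * z = (b₃ + b₄) * z by ring),
    e (show ((b₃ : ℂ) / 2 + b₄) * z - b₃ / 2 * z = b₄ * z by ring),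
    e (show ((b₂ : ℂ) + b₃ / 2) * z + (b₃ / 2 + b₄) * z = (b₂ + b₃ + b₄) * z by ring),
    e (show ((b₂ : ℂ) + b₃ / 2) * z - (b₃ / 2 + b₄) * z = (b₂ - b₄) * z by ring),
    e (show ((b₂ : ℂ) + b₃ / 2 - b₁) * z + b₃ / 2 * z = (b₂ + b₃ - b₁) * z by ring),
    e (show ((b₂ : ℂ) + b₃ / 2 - b₁) * z - b₃ / 2 * z = (b₂ - b₁) * z by ring),
    e (show ((b₂ : ℂ) + b₃ / 2 - b₁) * z + (b₃ / 2 + b₄) * z = (b₂ + b₃ + b₄ - b₁) * z by ring),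
    e (show ((b₂ : ℂ) + b₃ / 2 - b₁) * z - (b₃ / 2 + b₄) * z = (b₂ - b₁ - b₄) * z by ring),
    e (show ((b₂ : ℂ) + b₃ / 2) * z + b₃ / 2 * z = (b₂ + b₃) * z by ring),
    e (show ((b₂ : ℂ) + b₃ / 2) * z - b₃ / 2 * z = b₂ * z by ring)] at h
  linear_combination dedekindEta τ ^ (-3 : ℤ) * jTheta τ (b₅ * z) * jTheta τ (b₆ * z) *
    jTheta τ ((b₅ + b₆) * z) * jTheta τ ((b₃ + 2 * b₄) * z) * jTheta τ (b₃ * z) * h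
end
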